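/- arXiv:1309.0474 — 3 statements merged into one kernel-verified Lean document; each statement's English description precedes it below -/
import Mathlib

section
/- Comparison principle (classical-solution version of Proposition 3.1): let v̲, v̄ : [0,T)×ℝ^d → ℝ be nonnegative C^{1,2} functions of polynomial growth such that v̲_t + Lv̲ + F(y,v̲) ≥ 0 and v̄_t + Lv̄ + F(y,v̄) ≤ 0 at every (t,y) ∈ [0,T)×ℝ^d, and such that v̄(t,y) → +∞ as t → T locally uniformly in y. Then v̲(t,y) ≤ v̄(t,y) for all (t,y) ∈ [0,T)×ℝ^d. -/
open scoped BigOperators NNReal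

noncomputable section

/-- `ℝ^d` as Euclidean space. -/
abbrev Euc (d : ℕ) : Type := EuclideanSpace ℝ (Fin d)

/-- Partial derivative in the time variable, taken within the time set `s`. -/
noncomputable def partialT {d : ℕ} (s : Set ℝ) (w : ℝ → Euc d → ℝ) (t : ℝ) (y : Euc d) : ℝ :=
  derivWithin (fun r => w r y) s t

/-- `i`-th partial derivative in the space variable. -/
noncomputable def gradY {d : ℕ} (w : ℝ → Euc d → ℝ) (t : ℝ) (y : Euc d) (i : Fin d) : ℝ :=
  fderiv ℝ (w t) y (EuclideanSpace.single i 1)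

/-- `(i,j)` entry of the Hessian in the space variable. -/
noncomputable def hessY {d : ℕ} (w : ℝ → Euc d → ℝ) (t : ℝ) (y : Euc d) (i j : Fin d) : ℝ :=
  fderiv ℝ (fun z => fderiv ℝ (w t) z (EuclideanSpace.single j 1)) y (EuclideanSpace.single i 1)

/-- The operator `L w = ½ tr(σσᵀ D²_y w) + ⟨b, D_y w⟩`. -/
noncomputable def Lop {d n : ℕ} (b : Euc d → Euc d) (σ : Euc d → Matrix (Fin d) (Fin n) ℝ)
    (w : ℝ → Euc d → ℝ) (t : ℝ) (y : Euc d) : ℝ :=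
  (1 / 2) * ∑ i, ∑ j, (∑ k, σ y i k * σ y j k) * hessY w t y i j
    + ∑ i, b y i * gradY w t y i

/-- The nonlinearity `F(y,v) = λ(y) − v^{β+1}/(β η(y)^β) + θγ(y)v/(γ(y)^β+v^β)^{1/β} − θv`
with `β = 1/(p−1)` (so `1/β = p−1`); by Lean's conventions the third term is `0` when
`γ(y) = v = 0`. -/
noncomputable def hjbF {d : ℕ} (p θ : ℝ) (η lam gam : Euc d → ℝ) (y : Euc d) (v : ℝ) : ℝ :=
  lam y - v ^ (1 / (p - 1) + 1) / ((1 / (p - 1)) * η y ^ (1 / (p - 1)))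
    + θ * gam y * v / ((gam y ^ (1 / (p - 1)) + v ^ (1 / (p - 1))) ^ (p - 1))
    - θ * v

/-- `w` is `C^{1,2}` on `s × ℝ^d`: differentiable in time (within `s`), twice continuously
differentiable in space, with `w`, `∂_t w` and the spatial derivatives jointly continuous. -/
def IsC12On {d : ℕ} (s : Set ℝ) (w : ℝ → Euc d → ℝ) : Prop :=
  (∀ t ∈ s, ∀ y, DifferentiableWithinAt ℝ (fun r => w r y) s t) ∧
  (∀ t ∈ s, ContDiff ℝ 2 (w t)) ∧
  ContinuousOn (fun q : ℝ × Euc d => w q.1 q.2) (s ×ˢ Set.univ) ∧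
  ContinuousOn (fun q : ℝ × Euc d => partialT s w q.1 q.2) (s ×ˢ Set.univ) ∧
  ContinuousOn (fun q : ℝ × Euc d => fderiv ℝ (fun z => fderiv ℝ (w q.1) z) q.2) (s ×ˢ Set.univ)

/-- `w(t,y) → +∞` as `t → T`, locally uniformly in `y`, with `t` ranging in `[a,T)`. -/
def BlowsUpLocUnif {d : ℕ} (a T : ℝ) (w : ℝ → Euc d → ℝ) : Prop :=
  ∀ K : Set (Euc d), IsCompact K → ∀ M : ℝ,
    ∃ t₀, a ≤ t₀ ∧ t₀ < T ∧ ∀ t, t₀ ≤ t → t < T → ∀ y ∈ K, M ≤ w t y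

/-- Polynomial growth on `[a,T) × ℝ^d`: for each `s < T` a bound `C(1+‖y‖^q)` on `[a,s]`. -/
def PolyGrowthOn {d : ℕ} (a T : ℝ) (w : ℝ → Euc d → ℝ) : Prop :=
  ∀ s, a ≤ s → s < T → ∃ C > 0, ∃ q > 0,
    ∀ t, a ≤ t → t ≤ s → ∀ y : Euc d, |w t y| ≤ C * (1 + ‖y‖ ^ q)


theorem cp_max1d (g g' : ℝ → ℝ) (g'' : ℝ) (h1 : ∀ s, HasDerivAt g (g' s) s)
    (h2 : HasDerivAt g' g'' 0) (hmax : ∀ s, g s ≤ g 0) : g' 0 = 0 ∧ g'' ≤ 0 := by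
  have hd : deriv g = g' := funext fun s => (h1 s).deriv
  have hm : IsLocalMax g 0 := Filter.Eventually.of_forall hmax
  have h0 : g' 0 = 0 := hm.hasDerivAt_eq_zero (h1 0)
  refine ⟨h0, ?_⟩
  by_contra hc
  push Not at hc
  have hmin : IsLocalMin g 0 := by
    apply isLocalMin_of_deriv_deriv_pos
    · rw [hd, h2.deriv]; exact hc
    · rw [hd]; exact h0
    · exact (h1 0).continuousAt
  have he : g =ᶠ[nhds 0] fun _ => g 0 := by
    filter_upwards [hmin] with s hs
    exact le_antisymm (hmax s) hs
  have he' : deriv g =ᶠ[nhds 0] deriv fun _ => g 0 := he.deriv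
  have := he'.deriv_eq
  rw [hd, h2.deriv] at this
  simp at this
  linarith

theorem cp_tder (f : ℝ → ℝ) (f' t S : ℝ) (htS : t < S)
    (h : HasDerivWithinAt f f' (Set.Ioi t) t) (hmax : ∀ s, t < s → s < S → f s ≤ f t) :
    f' ≤ 0 := by
  rw [hasDerivWithinAt_iff_tendsto_slope' (by simp)] at h
  refine le_of_tendsto h ?_
  filter_upwards [Ioo_mem_nhdsGT htS] with s hs
  rw [slope_def_field]
  exact div_nonpos_of_nonpos_of_nonneg (by linarith [hmax s hs.1 hs.2]) (by linarith [hs.1])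

theorem cp_Lop {d n : ℕ} (b : Euc d → Euc d) (σ : Euc d → Matrix (Fin d) (Fin n) ℝ)
    (w : ℝ → Euc d → ℝ) (t : ℝ) (y : Euc d) (hw : ContDiff ℝ 2 (w t)) :
    Lop b σ w t y = (1 / 2) * ∑ k, fderiv ℝ (fderiv ℝ (w t)) y (WithLp.toLp 2 fun i => σ y i k)
      (WithLp.toLp 2 fun i => σ y i k) + fderiv ℝ (w t) y (b y) := by
  have hexp : ∀ v : Euc d, v = ∑ i, v i • EuclideanSpace.single i (1 : ℝ) := by
    intro v
    ext j
    simp [Finset.sum_apply, Pi.single_apply]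
  have hdiff : DifferentiableAt ℝ (fderiv ℝ (w t)) y :=
    ((hw.fderiv_right (m := 1) (by norm_num)).differentiable (by norm_num)) y
  have hh : ∀ i j, hessY w t y i j = fderiv ℝ (fderiv ℝ (w t)) y (EuclideanSpace.single i 1)
      (EuclideanSpace.single j 1) := by
    intro i j
    unfold hessY
    rw [fderiv_clm_apply hdiff (by fun_prop)]
    simp
  unfold Lop gradY
  congr 1
  · congr 1
    have : ∀ k, fderiv ℝ (fderiv ℝ (w t)) y (WithLp.toLp 2 fun i => σ y i k)
      (WithLp.toLp 2 fun i => σ y i k) = ∑ i, ∑ j, σ y i k * σ y j k * hessY w t y i j := by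
      intro k
      rw [hexp (WithLp.toLp 2 fun i => σ y i k)]
      simp only [map_sum, map_smul, sum_apply, smul_apply,
        smul_eq_mul, hh, Finset.mul_sum, mul_assoc]
      rw [Finset.sum_comm]
      refine Finset.sum_congr rfl fun i _ => Finset.sum_congr rfl fun j _ => by ring
    simp only [this, Finset.sum_mul]
    rw [Finset.sum_comm' (t' := Finset.univ) (s' := fun _ => Finset.univ) (by simp)]
    rw [Finset.sum_comm]
    rw [Finset.sum_congr rfl fun i _ => Finset.sum_comm]
    rw [Finset.sum_comm]
  · conv_rhs => rw [hexp (b y)]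
    simp [map_sum]

theorem cp_line {d : ℕ} (f : Euc d → ℝ) (hf : ContDiff ℝ 2 f) (y v : Euc d) :
    (∀ s : ℝ, HasDerivAt (fun s : ℝ => f (y + s • v)) (fderiv ℝ f (y + s • v) v) s) ∧
    HasDerivAt (fun s : ℝ => fderiv ℝ f (y + s • v) v) (fderiv ℝ (fderiv ℝ f) y v v) 0 := by
  have hl : ∀ s : ℝ, HasDerivAt (fun s : ℝ => y + s • v) v s := by
    intro s
    simpa using ((hasDerivAt_id s).smul_const v).const_add y
  constructor
  · intro s
    exact ((hf.differentiable (by norm_num)) _).hasFDerivAt.comp_hasDerivAt s (hl s)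
  · have hdiff : DifferentiableAt ℝ (fderiv ℝ f) (y + (0:ℝ) • v) :=
      ((hf.fderiv_right (m := 1) (by norm_num)).differentiable (by norm_num)) _
    have := hdiff.hasFDerivAt.comp_hasDerivAt (0:ℝ) (hl 0)
    have := this.clm_apply (hasDerivAt_const (0:ℝ) v)
    simpa using this

theorem cp_pen {d : ℕ} (k : ℕ) (A : ℝ) (y v : Euc d) :
    ∃ g' : ℝ → ℝ, ∃ g'' : ℝ,
    (∀ s : ℝ, HasDerivAt (fun s : ℝ => A * (1 + ‖y + s • v‖ ^ 2) ^ (k + 2)) (g' s) s) ∧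
    HasDerivAt g' g'' 0 ∧
    (0 ≤ A → g' 0 ≤ (k + 2) * ‖v‖ * (A * (1 + ‖y‖ ^ 2) ^ (k + 2)) ∧
      g'' ≤ 4 * (k + 2) ^ 2 * ‖v‖ ^ 2 * (A * (1 + ‖y‖ ^ 2) ^ (k + 2))) := by
  set B := inner ℝ y v with hB
  let P : ℝ → ℝ := fun s => 1 + ‖y‖ ^ 2 + 2 * B * s + ‖v‖ ^ 2 * s ^ 2
  let P' : ℝ → ℝ := fun s => 2 * B + ‖v‖ ^ 2 * (2 * s)
  have hP : ∀ s : ℝ, 1 + ‖y + s • v‖ ^ 2 = P s := by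
    intro s
    rw [norm_add_sq_real, inner_smul_right, norm_smul, mul_pow, Real.norm_eq_abs, sq_abs]
    simp only [P]; ring
  have hPd : ∀ s, HasDerivAt P (P' s) s := by
    intro s
    have h := (((hasDerivAt_id s).const_mul (2 * B)).const_add (1 + ‖y‖ ^ 2)).add
      (((hasDerivAt_id s).pow 2).const_mul (‖v‖ ^ 2))
    refine h.congr_deriv ?_
    simp [P']
  have hP'd : ∀ s, HasDerivAt P' (2 * ‖v‖ ^ 2) s := by
    intro s
    have h := ((((hasDerivAt_id s).const_mul (2:ℝ)).const_mul (‖v‖ ^ 2)).const_add (2 * B))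
    refine h.congr_deriv ?_
    ring
  refine ⟨fun s => A * ((k + 2) * P s ^ (k + 1) * P' s),
    A * (((k + 2) * ((k + 1) * P 0 ^ k * P' 0)) * P' 0
      + (k + 2) * P 0 ^ (k + 1) * (2 * ‖v‖ ^ 2)), ?_, ?_, ?_⟩
  · intro s
    simp only [hP]
    refine (((hPd s).pow (k + 2)).const_mul A).congr_deriv ?_
    push_cast
    simp
  · have h := (((((hPd 0).pow (k + 1)).const_mul ((k:ℝ) + 2)).mul (hP'd 0)).const_mul A)
    refine h.congr_deriv ?_
    push_cast
    simp
  · intro hA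
    have e0 : P 0 = 1 + ‖y‖ ^ 2 := by simp [P]
    have e1 : P' 0 = 2 * B := by simp [P']
    simp only [e0, e1]
    set a := 1 + ‖y‖ ^ 2 with ha
    have ha1 : 1 ≤ a := by nlinarith [sq_nonneg ‖y‖]
    have hBle : |B| ≤ ‖y‖ * ‖v‖ := abs_real_inner_le_norm y v
    have hB1 : 2 * B ≤ a * ‖v‖ := by
      nlinarith [le_abs_self B, norm_nonneg v, sq_nonneg (‖y‖ - 1),
        mul_nonneg (norm_nonneg v) (sq_nonneg (‖y‖ - 1))]
    have hB2 : B ^ 2 ≤ a * ‖v‖ ^ 2 := by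
      have : B ^ 2 ≤ (‖y‖ * ‖v‖) ^ 2 := sq_le_sq' (by linarith [neg_abs_le B]) (by linarith [le_abs_self B])
      nlinarith [sq_nonneg ‖v‖]
    have hk : (0:ℝ) ≤ k := Nat.cast_nonneg k
    have hak : 0 ≤ a ^ k := by positivity
    have hak1 : 0 ≤ a ^ (k+1) := by positivity
    constructor
    · calc A * ((k + 2) * a ^ (k + 1) * (2 * B)) ≤ A * ((k + 2) * a ^ (k + 1) * (a * ‖v‖)) := by
            gcongr
        _ = _ := by ring
    · have s1 : a ^ (k+1) ≤ a ^ (k+2) := pow_le_pow_right₀ ha1 (by omega)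
      calc A * ((k + 2) * ((k + 1) * a ^ k * (2 * B)) * (2 * B) + (k + 2) * a ^ (k + 1) * (2 * ‖v‖ ^ 2))
          = A * (4 * (k + 2) * (k + 1) * a ^ k * B ^ 2 + 2 * (k + 2) * a ^ (k + 1) * ‖v‖ ^ 2) := by ring
        _ ≤ A * (4 * (k + 2) * (k + 1) * a ^ k * (a * ‖v‖ ^ 2) + 2 * (k + 2) * a ^ (k + 1) * ‖v‖ ^ 2) := by
            gcongr
        _ = A * ((4 * (k + 2) * (k + 1) + 2 * (k + 2)) * ‖v‖ ^ 2 * a ^ (k + 1)) := by ring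
        _ ≤ A * ((4 * (k + 2) ^ 2) * ‖v‖ ^ 2 * a ^ (k + 2)) := by
            gcongr
            nlinarith
        _ = _ := by ring

theorem cp_F {d : ℕ} (p θ : ℝ) (hp : 1 < p) (hθ : 0 ≤ θ) (η lam gam : Euc d → ℝ) (y : Euc d)
    (hη : 0 < η y) (hg : 0 ≤ gam y) (v w : ℝ) (hv : 0 ≤ v) (hvw : v ≤ w) :
    hjbF p θ η lam gam y w ≤ hjbF p θ η lam gam y v := by
  unfold hjbF
  have hp1 : 0 < p - 1 := by linarith
  have hb : 0 < 1 / (p - 1) := by positivity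
  have hw : 0 ≤ w := hv.trans hvw
  have h1 : v ^ (1 / (p - 1) + 1) / ((1 / (p - 1)) * η y ^ (1 / (p - 1))) ≤
      w ^ (1 / (p - 1) + 1) / ((1 / (p - 1)) * η y ^ (1 / (p - 1))) := by
    have := Real.rpow_pos_of_pos hη (1 / (p - 1))
    gcongr
  have h2 : gam y * w / ((gam y ^ (1 / (p - 1)) + w ^ (1 / (p - 1))) ^ (p - 1)) - w ≤
      gam y * v / ((gam y ^ (1 / (p - 1)) + v ^ (1 / (p - 1))) ^ (p - 1)) - v := by
    rcases hg.eq_or_lt with h0 | h0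
    · rw [← h0]; simp; exact hvw
    · set β := 1 / (p - 1) with hβ
      have hgp : 0 < gam y ^ β := Real.rpow_pos_of_pos h0 _
      have hvp : 0 ≤ v ^ β := Real.rpow_nonneg hv _
      have hwp : 0 ≤ w ^ β := Real.rpow_nonneg hw _
      have hvw' : v ^ β ≤ w ^ β := Real.rpow_le_rpow hv hvw hb.le
      have hDv : 0 < (gam y ^ β + v ^ β) ^ (p - 1) := Real.rpow_pos_of_pos (by linarith) _
      have hD : (gam y ^ β + v ^ β) ^ (p - 1) ≤ (gam y ^ β + w ^ β) ^ (p - 1) :=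
        Real.rpow_le_rpow (by linarith) (by linarith) hp1.le
      have hgD : gam y ≤ (gam y ^ β + w ^ β) ^ (p - 1) := by
        calc gam y = (gam y ^ β) ^ (p - 1) := by
              rw [← Real.rpow_mul hg, hβ, one_div_mul_cancel hp1.ne', Real.rpow_one]
          _ ≤ _ := Real.rpow_le_rpow hgp.le (by linarith) hp1.le
      set D := (gam y ^ β + w ^ β) ^ (p - 1)
      set D' := (gam y ^ β + v ^ β) ^ (p - 1)
      have q1 : gam y / D ≤ gam y / D' := by gcongr
      have q2 : gam y / D ≤ 1 := (div_le_one (by linarith)).2 hgD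
      have r1 : gam y * w / D = w * (gam y / D) := by ring
      have r2 : gam y * v / D' = v * (gam y / D') := by ring
      rw [r1, r2]
      nlinarith [mul_le_mul_of_nonneg_left q1 hv, mul_nonneg (sub_nonneg.2 hvw) (sub_nonneg.2 q2)]
  have h3 := mul_le_mul_of_nonneg_left h2 hθ
  have r1 : θ * gam y * w / ((gam y ^ (1 / (p - 1)) + w ^ (1 / (p - 1))) ^ (p - 1)) =
    θ * (gam y * w / ((gam y ^ (1 / (p - 1)) + w ^ (1 / (p - 1))) ^ (p - 1))) := by ring
  have r2 : θ * gam y * v / ((gam y ^ (1 / (p - 1)) + v ^ (1 / (p - 1))) ^ (p - 1)) =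
    θ * (gam y * v / ((gam y ^ (1 / (p - 1)) + v ^ (1 / (p - 1))) ^ (p - 1))) := by ring
  rw [r1, r2]
  linarith

set_option maxHeartbeats 4000000 in
/-- comparison principle, classical-solution version of Proposition 3.1:
a nonnegative subsolution of polynomial growth lies below any nonnegative supersolution of
polynomial growth that blows up at the terminal time locally uniformly. -/
theorem comparison_principle
    (d n : ℕ) (hd : 1 ≤ d) (hn : 1 ≤ n)
    (T p θ κ₀ : ℝ) (hT : 0 < T) (hp : 1 < p) (hθ : 0 ≤ θ) (hκ₀ : 0 < κ₀)
    (b : Euc d → Euc d) (σ : Euc d → Matrix (Fin d) (Fin n) ℝ)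
    (hbLip : ∃ K : ℝ≥0, LipschitzWith K b) (hbBdd : ∃ C, ∀ y, ‖b y‖ ≤ C)
    (hσLip : ∃ K, ∀ y y' : Euc d, ∀ i k, |σ y i k - σ y' i k| ≤ K * ‖y - y'‖)
    (hσBdd : ∃ C, ∀ y i k, |σ y i k| ≤ C)
    (hell : ∃ ν > 0, ∀ (y : Euc d) (z : Fin d → ℝ),
      ν * ∑ i, z i ^ 2 ≤ ∑ i, ∑ j, (∑ k, σ y i k * σ y j k) * z j * z i)
    (η lam gam : Euc d → ℝ)
    (hηC2 : ContDiff ℝ 2 η)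
    (hηBdd : ∃ C, ∀ y, |η y| ≤ C ∧ ‖fderiv ℝ η y‖ ≤ C ∧ ‖fderiv ℝ (fderiv ℝ η) y‖ ≤ C)
    (hηκ : ∀ y, κ₀ ≤ η y)
    (hlamCont : Continuous lam) (hlam0 : ∀ y, 0 ≤ lam y) (hlamBdd : ∃ C, ∀ y, lam y ≤ C)
    (hgamCont : Continuous gam) (hgam0 : ∀ y, 0 ≤ gam y) (hgamBdd : ∃ C, ∀ y, gam y ≤ C)
    (vlo vhi : ℝ → Euc d → ℝ)
    (hlo0 : ∀ t ∈ Set.Ico (0 : ℝ) T, ∀ y, 0 ≤ vlo t y)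
    (hhi0 : ∀ t ∈ Set.Ico (0 : ℝ) T, ∀ y, 0 ≤ vhi t y)
    (hloC12 : IsC12On (Set.Ico 0 T) vlo) (hhiC12 : IsC12On (Set.Ico 0 T) vhi)
    (hloPG : PolyGrowthOn 0 T vlo) (hhiPG : PolyGrowthOn 0 T vhi)
    (hsub : ∀ t ∈ Set.Ico (0 : ℝ) T, ∀ y,
      0 ≤ partialT (Set.Ico 0 T) vlo t y + Lop b σ vlo t y + hjbF p θ η lam gam y (vlo t y))
    (hsup : ∀ t ∈ Set.Ico (0 : ℝ) T, ∀ y,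
      partialT (Set.Ico 0 T) vhi t y + Lop b σ vhi t y + hjbF p θ η lam gam y (vhi t y) ≤ 0)
    (hblow : BlowsUpLocUnif 0 T vhi) :
    ∀ t ∈ Set.Ico (0 : ℝ) T, ∀ y, vlo t y ≤ vhi t y := by
  classical
  obtain ⟨Cb, hCb⟩ := hbBdd
  obtain ⟨Cσ, hCσ⟩ := hσBdd
  have hCb0 : 0 ≤ Cb := (norm_nonneg _).trans (hCb 0)
  -- shifted comparison
  have key : ∀ δ, 0 < δ → ∀ t, 0 ≤ t → t + δ < T → ∀ y, vlo t y ≤ vhi (t + δ) y := by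
    intro δ hδ t1 ht1 ht1δ y1
    set S := T - δ with hS
    have hS0 : 0 < S := by linarith
    have hST : S < T := by linarith
    obtain ⟨C, hC, q, hq, hpg⟩ := hloPG S hS0.le hST
    set N := q with hN
    -- exponent m = N + 2
    set κ : ℝ := 1 + (2 * n * (N + 2) ^ 2 * (d * Cσ ^ 2) + (N + 2) * Cb) with hκ
    have hpen : ∀ ε, 0 < ε → vlo t1 y1 - vhi (t1 + δ) y1 ≤
        ε * Real.exp (-κ * t1) * (1 + ‖y1‖ ^ 2) ^ (N + 2) := by
      intro ε hε
      by_contra hcon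
      push Not at hcon
      set Ψ : ℝ → Euc d → ℝ := fun t y => vlo t y - vhi (t + δ) y -
        ε * Real.exp (-κ * t) * (1 + ‖y‖ ^ 2) ^ (N + 2) with hΨ
      have hΨ1 : 0 < Ψ t1 y1 := by simp only [hΨ]; linarith
      have hκ0 : 0 ≤ κ := by positivity
      -- growth
      set ε' := ε * Real.exp (-κ * S) with hε'
      have hε'0 : 0 < ε' := by positivity
      obtain ⟨R, hR0, hR⟩ : ∃ R : ℝ, 0 < R ∧ ∀ r, R < r → 2 * C ≤ ε' * (1 + r ^ 2) := by
        refine ⟨1 + 2 * C / ε', by positivity, fun r hr => ?_⟩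
        have h1 : 2 * C / ε' ≤ 1 + r ^ 2 := by
          have : 0 ≤ 2 * C / ε' := by positivity
          nlinarith
        rw [div_le_iff₀ hε'0] at h1
        linarith
      have hout : ∀ t, 0 ≤ t → t < S → ∀ y, R < ‖y‖ → Ψ t y ≤ 0 := by
        intro t ht htS y hy
        have ha1 : 1 ≤ 1 + ‖y‖ ^ 2 := by nlinarith [sq_nonneg ‖y‖]
        have e1 : ‖y‖ ^ q ≤ (1 + ‖y‖ ^ 2) ^ N := by
          exact pow_le_pow_left₀ (norm_nonneg _) (by nlinarith [sq_nonneg (‖y‖ - 1)]) q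
        have e2 : 1 ≤ (1 + ‖y‖ ^ 2) ^ N := one_le_pow₀ ha1
        have e3 := le_trans (le_abs_self _) (hpg t ht htS.le y)
        have e4 := hhi0 (t + δ) ⟨by linarith, by linarith⟩ y
        have e5 : ε' ≤ ε * Real.exp (-κ * t) := by
          simp only [hε']
          gcongr ε * Real.exp ?_
          nlinarith
        have e6 : C * (1 + ‖y‖ ^ q) ≤ ε * Real.exp (-κ * t) * (1 + ‖y‖ ^ 2) ^ (N + 2) := by
          calc C * (1 + ‖y‖ ^ q) ≤ C * ((1 + ‖y‖ ^ 2) ^ N + (1 + ‖y‖ ^ 2) ^ N) := by gcongr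
            _ = 2 * C * (1 + ‖y‖ ^ 2) ^ N := by ring
            _ ≤ ε' * (1 + ‖y‖ ^ 2) * (1 + ‖y‖ ^ 2) ^ N := by
              exact mul_le_mul_of_nonneg_right (hR _ hy) (by positivity)
            _ = ε' * (1 + ‖y‖ ^ 2) ^ (N + 1) := by ring
            _ ≤ ε * Real.exp (-κ * t) * (1 + ‖y‖ ^ 2) ^ (N + 2) := by
              exact mul_le_mul e5 (pow_le_pow_right₀ ha1 (by omega)) (by positivity) (by positivity)
        simp only [hΨ]
        linarith
      -- near terminal time
      obtain ⟨t₀, ht₀0, ht₀T, ht₀⟩ := hblow (Metric.closedBall 0 R) (isCompact_closedBall 0 R)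
        (C * (1 + R ^ q))
      have hlate : ∀ t, 0 ≤ t → t < S → t₀ ≤ t + δ → ∀ y, ‖y‖ ≤ R → Ψ t y ≤ 0 := by
        intro t ht htS htt y hy
        have e1 := ht₀ (t + δ) htt (by linarith) y (by simpa using hy)
        have e3 := le_trans (le_abs_self _) (hpg t ht htS.le y)
        have e2 : C * (1 + ‖y‖ ^ q) ≤ C * (1 + R ^ q) := by gcongr
        have e4 : 0 ≤ ε * Real.exp (-κ * t) * (1 + ‖y‖ ^ 2) ^ (N + 2) := by positivity
        simp only [hΨ]
        linarith
      -- maximum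
      set τ := max (t₀ - δ) t1 with hτ
      have hτS : τ < S := max_lt (by linarith) (by linarith)
      have hcont : ContinuousOn (fun z : ℝ × Euc d => Ψ z.1 z.2)
          (Set.Icc 0 τ ×ˢ Metric.closedBall 0 R) := by
        have c1 : ContinuousOn (fun z : ℝ × Euc d => vlo z.1 z.2)
            (Set.Icc 0 τ ×ˢ Metric.closedBall 0 R) :=
          hloC12.2.2.1.mono fun z hz => ⟨⟨hz.1.1, by linarith [hz.1.2]⟩, trivial⟩
        have c2 : ContinuousOn (fun z : ℝ × Euc d => vhi (z.1 + δ) z.2)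
            (Set.Icc 0 τ ×ˢ Metric.closedBall 0 R) :=
          hhiC12.2.2.1.comp (f := fun z : ℝ × Euc d => (z.1 + δ, z.2)) (by fun_prop)
            fun z hz => ⟨⟨by simp only; linarith [hz.1.1], by simp only; linarith [hz.1.2]⟩, trivial⟩
        exact (c1.sub c2).sub (by fun_prop)
      have hmem1 : (t1, y1) ∈ Set.Icc 0 τ ×ˢ Metric.closedBall (0 : Euc d) R := by
        refine ⟨⟨ht1, le_max_right _ _⟩, ?_⟩
        by_contra hh
        have := hout t1 ht1 (by linarith) y1 (by simpa using hh)
        linarith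
      obtain ⟨⟨ts, ys⟩, ⟨hts, hys⟩, hmax⟩ := (isCompact_Icc.prod
        (isCompact_closedBall (0 : Euc d) R)).exists_isMaxOn ⟨_, hmem1⟩ hcont
      have hmaxpos : 0 < Ψ ts ys := lt_of_lt_of_le hΨ1 (hmax hmem1)
      simp only at hts hys
      have hts0 : 0 ≤ ts := hts.1
      have htsS : ts < S := lt_of_le_of_lt hts.2 hτS
      have hglob : ∀ t, 0 ≤ t → t < S → ∀ y, Ψ t y ≤ Ψ ts ys := by
        intro t ht htS y
        by_cases hy : R < ‖y‖
        · exact (hout t ht htS y hy).trans hmaxpos.le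
        push Not at hy
        by_cases hh : t ≤ τ
        · exact hmax (show (t, y) ∈ Set.Icc 0 τ ×ˢ Metric.closedBall (0 : Euc d) R from
            ⟨⟨ht, hh⟩, by simpa using hy⟩)
        · push Not at hh
          exact (hlate t ht htS (by linarith [le_max_left (t₀ - δ) t1]) y hy).trans hmaxpos.le
      have hm1 : ts ∈ Set.Ico (0:ℝ) T := ⟨hts0, by linarith⟩
      have hm2 : ts + δ ∈ Set.Ico (0:ℝ) T := ⟨by linarith, by linarith⟩
      set φ := ε * Real.exp (-κ * ts) * (1 + ‖ys‖ ^ 2) ^ (N + 2) with hφ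
      have hφ0 : 0 < φ := by positivity
      -- time derivative
      have htime : partialT (Set.Ico 0 T) vlo ts ys - partialT (Set.Ico 0 T) vhi (ts + δ) ys
          + κ * φ ≤ 0 := by
        have d1 : HasDerivWithinAt (fun r => vlo r ys) (partialT (Set.Ico 0 T) vlo ts ys)
            (Set.Ioi ts) ts := by
          have h := (hloC12.1 ts hm1 ys).hasDerivWithinAt
          refine (h.mono (s := Set.Ioo ts T) fun x hx => ⟨by linarith [hx.1], hx.2⟩).mono_of_mem_nhdsWithin ?_
          exact Ioo_mem_nhdsGT hm1.2
        have d2 : HasDerivWithinAt (fun r => vhi (r + δ) ys)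
            (partialT (Set.Ico 0 T) vhi (ts + δ) ys) (Set.Ioi ts) ts := by
          have h := (hhiC12.1 (ts + δ) hm2 ys).hasDerivWithinAt.hasDerivAt
            (Ico_mem_nhds (by linarith) hm2.2)
          exact (h.comp_add_const ts δ).hasDerivWithinAt
        have d3 : HasDerivAt (fun r => ε * Real.exp (-κ * r) * (1 + ‖ys‖ ^ 2) ^ (N + 2))
            (-κ * φ) ts := by
          have h := ((((hasDerivAt_id ts).const_mul (-κ)).exp).const_mul ε).mul_const
            ((1 + ‖ys‖ ^ 2) ^ (N + 2))
          refine h.congr_deriv ?_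
          simp only [hφ, id]; ring
        have := cp_tder _ _ ts S htsS ((d1.sub d2).sub d3.hasDerivWithinAt)
          (fun s hs hsS => hglob s (by linarith) hsS ys)
        linarith
      -- space derivatives
      have hA : 0 ≤ ε * Real.exp (-κ * ts) := by positivity
      have f1 := hloC12.2.1 ts hm1
      have f2 := hhiC12.2.1 (ts + δ) hm2
      have hsp : ∀ v : Euc d,
          fderiv ℝ (vlo ts) ys v - fderiv ℝ (vhi (ts + δ)) ys v ≤ (N + 2) * ‖v‖ * φ ∧
          fderiv ℝ (fderiv ℝ (vlo ts)) ys v v - fderiv ℝ (fderiv ℝ (vhi (ts + δ))) ys v v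
            ≤ 4 * (N + 2) ^ 2 * ‖v‖ ^ 2 * φ := by
        intro v
        obtain ⟨a1, a2⟩ := cp_line _ f1 ys v
        obtain ⟨b1, b2⟩ := cp_line _ f2 ys v
        obtain ⟨g', g'', c1, c2, c3⟩ := cp_pen N (ε * Real.exp (-κ * ts)) ys v
        obtain ⟨r1, r2⟩ := cp_max1d _ _ _ (fun s => ((a1 s).sub (b1 s)).sub (c1 s))
          ((a2.sub b2).sub c2) (fun s => by
            have := hglob ts hts0 htsS (ys + s • v)
            simpa [hΨ] using this)
        obtain ⟨r3, r4⟩ := c3 hA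
        simp at r1
        constructor <;> linarith
      have s1 := hsub ts hm1 ys
      have s2 := hsup (ts + δ) hm2 ys
      rw [cp_Lop _ _ _ _ _ f1] at s1
      rw [cp_Lop _ _ _ _ _ f2] at s2
      have hlt : vhi (ts + δ) ys ≤ vlo ts ys := by
        have : 0 < vlo ts ys - vhi (ts + δ) ys - φ := hmaxpos
        linarith
      have s3 := cp_F p θ hp hθ η lam gam ys (by linarith [hηκ ys]) (hgam0 ys) _ _
        (hhi0 _ hm2 ys) hlt
      have s4 : fderiv ℝ (vlo ts) ys (b ys) - fderiv ℝ (vhi (ts + δ)) ys (b ys)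
          ≤ (N + 2) * Cb * φ := by
        refine (hsp (b ys)).1.trans ?_
        gcongr
        exact hCb ys
      have hcn : ∀ k, ‖(WithLp.toLp 2 fun i => σ ys i k : Euc d)‖ ^ 2 ≤ d * Cσ ^ 2 := by
        intro k
        rw [EuclideanSpace.norm_sq_eq]
        calc ∑ i, ‖σ ys i k‖ ^ 2 ≤ ∑ i : Fin d, Cσ ^ 2 := by
              refine Finset.sum_le_sum fun i _ => ?_
              have := hCσ ys i k
              rw [Real.norm_eq_abs]
              gcongr
          _ = _ := by simp
      have s5 : ∑ k, fderiv ℝ (fderiv ℝ (vlo ts)) ys (WithLp.toLp 2 fun i => σ ys i k)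
            (WithLp.toLp 2 fun i => σ ys i k)
          - ∑ k, fderiv ℝ (fderiv ℝ (vhi (ts + δ))) ys (WithLp.toLp 2 fun i => σ ys i k)
            (WithLp.toLp 2 fun i => σ ys i k) ≤ n * (4 * (N + 2) ^ 2 * (d * Cσ ^ 2) * φ) := by
        rw [← Finset.sum_sub_distrib]
        calc _ ≤ ∑ k : Fin n, 4 * ((N:ℝ) + 2) ^ 2 * (d * Cσ ^ 2) * φ := by
              refine Finset.sum_le_sum fun k _ => (hsp _).2.trans ?_
              gcongr
              exact hcn k
          _ = _ := by simp
      have e : κ * φ = φ + (n * (4 * (N + 2) ^ 2 * (d * Cσ ^ 2) * φ)) / 2 + (N + 2) * Cb * φ := by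
        rw [hκ]; ring
      linarith
    -- ε → 0
    have hfin : vlo t1 y1 - vhi (t1 + δ) y1 ≤ 0 := by
      have hX : 0 < Real.exp (-κ * t1) * (1 + ‖y1‖ ^ 2) ^ (N + 2) := by positivity
      refine le_of_forall_pos_le_add fun e he => ?_
      have := hpen (e / (Real.exp (-κ * t1) * (1 + ‖y1‖ ^ 2) ^ (N + 2))) (by positivity)
      rw [mul_assoc, div_mul_cancel₀ _ hX.ne'] at this
      linarith
    linarith
  -- δ → 0
  intro t ht y
  have hc : ContinuousWithinAt (fun r => vhi r y) (Set.Ico 0 T) t :=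
    (hhiC12.1 t ht y).continuousWithinAt
  have hc' : Filter.Tendsto (fun r => vhi r y) (nhdsWithin t (Set.Ioi t)) (nhds (vhi t y)) := by
    refine (hc.mono (s := Set.Ioo t T) fun x hx => ⟨by linarith [hx.1, ht.1], hx.2⟩).mono_of_mem_nhdsWithin ?_
    exact Ioo_mem_nhdsGT ht.2
  refine ge_of_tendsto hc' ?_
  filter_upwards [Ioo_mem_nhdsGT ht.2] with s hs
  have := key (s - t) (by linarith [hs.1]) t ht.1 (by linarith [hs.2]) y
  rwa [add_sub_cancel] at this
end
end

section
/- Uniqueness (from Proposition 3.1): there is at most one nonnegative C^{1,2} function v : [0,T)×ℝ^d → ℝ of polynomial growth satisfying v_t + Lv + F(y,v) = 0 on [0,T)×ℝ^d and v(t,y) → +∞ as t → T locally uniformly in y; that is, any two such functions coincide on [0,T)×ℝ^d. -/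
open scoped BigOperators NNReal

noncomputable section

lemma hjbF_anti {d : ℕ} (p θ : ℝ) (hp : 1 < p) (hθ : 0 ≤ θ) (η lam gam : Euc d → ℝ) (y : Euc d)
    (hη : 0 < η y) (hg : 0 ≤ gam y) (u v : ℝ) (hu : 0 ≤ u) (huv : u ≤ v) :
    hjbF p θ η lam gam y v ≤ hjbF p θ η lam gam y u := by
  unfold hjbF
  have hβ : 0 < 1 / (p - 1) := by
    have : 0 < p - 1 := by linarith
    positivity
  have hβp : 1 / (p - 1) * (p - 1) = 1 := by
    have : p - 1 ≠ 0 := by linarith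
    field_simp
  set β := 1 / (p - 1) with hβdef
  have hp1 : 0 < p - 1 := by linarith
  have hv : 0 ≤ v := hu.trans huv
  have h1 : u ^ (β + 1) / (β * η y ^ β) ≤ v ^ (β + 1) / (β * η y ^ β) := by
    have : 0 < η y ^ β := Real.rpow_pos_of_pos hη _
    gcongr
  have h2 : gam y * v / ((gam y ^ β + v ^ β) ^ (p - 1)) - v ≤
      gam y * u / ((gam y ^ β + u ^ β) ^ (p - 1)) - u := by
    rcases hg.eq_or_lt with h0 | h0
    · rw [← h0]; simp; exact huv
    · have hgb : 0 < gam y ^ β := Real.rpow_pos_of_pos h0 _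
      have hub : 0 ≤ u ^ β := Real.rpow_nonneg hu _
      have huvb : u ^ β ≤ v ^ β := Real.rpow_le_rpow hu huv hβ.le
      have hDu : gam y ≤ (gam y ^ β + u ^ β) ^ (p - 1) := by
        calc gam y = (gam y ^ β) ^ (p - 1) := by
              rw [← Real.rpow_mul hg, hβp, Real.rpow_one]
          _ ≤ _ := Real.rpow_le_rpow hgb.le (by linarith) hp1.le
      have hDuv : (gam y ^ β + u ^ β) ^ (p - 1) ≤ (gam y ^ β + v ^ β) ^ (p - 1) :=
        Real.rpow_le_rpow (by positivity) (by linarith) hp1.le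
      set A := (gam y ^ β + u ^ β) ^ (p - 1)
      set B := (gam y ^ β + v ^ β) ^ (p - 1)
      have hA : 0 < A := by linarith
      have r1 : gam y / A ≤ 1 := (div_le_one hA).2 hDu
      have r2 : gam y / B ≤ gam y / A := by gcongr
      have e1 : gam y * v / B = v * (gam y / B) := by ring
      have e2 : gam y * u / A = u * (gam y / A) := by ring
      rw [e1, e2]
      nlinarith
  have e1 : θ * gam y * v / ((gam y ^ β + v ^ β) ^ (p - 1)) =
    θ * (gam y * v / ((gam y ^ β + v ^ β) ^ (p - 1))) := by ring
  have e2 : θ * gam y * u / ((gam y ^ β + u ^ β) ^ (p - 1)) =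
    θ * (gam y * u / ((gam y ^ β + u ^ β) ^ (p - 1))) := by ring
  rw [e1, e2]
  nlinarith [mul_le_mul_of_nonneg_left h2 hθ]

/-- The `k`-th column of a matrix as a Euclidean vector. -/
def colV {d n : ℕ} (A : Matrix (Fin d) (Fin n) ℝ) (k : Fin n) : Euc d :=
  WithLp.toLp 2 (fun i => A i k)

/-- Coordinate-free form of the spatial operator. -/
def Lfree {d n : ℕ} (b : Euc d) (A : Matrix (Fin d) (Fin n) ℝ) (f : Euc d → ℝ) (y : Euc d) : ℝ :=
  (1 / 2) * ∑ k, fderiv ℝ (fderiv ℝ f) y (colV A k) (colV A k) + fderiv ℝ f y b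

lemma euc_sum {d : ℕ} (x : Euc d) : x = ∑ i, x i • EuclideanSpace.single i (1 : ℝ) := by
  ext j
  simp [Finset.sum_apply, Pi.single_apply]

lemma contDiff_fderiv_diff {d : ℕ} {f : Euc d → ℝ} (hf : ContDiff ℝ 2 f) :
    Differentiable ℝ (fderiv ℝ f) :=
  (hf.fderiv_right (m := 1) (by norm_num)).differentiable (by norm_num)

lemma Lop_eq {d n : ℕ} (b : Euc d → Euc d) (σ : Euc d → Matrix (Fin d) (Fin n) ℝ)
    (w : ℝ → Euc d → ℝ) (t : ℝ) (y : Euc d) (hf : ContDiff ℝ 2 (w t)) :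
    Lop b σ w t y = Lfree (b y) (σ y) (w t) y := by
  have hh : ∀ i j, hessY w t y i j = fderiv ℝ (fderiv ℝ (w t)) y (EuclideanSpace.single i 1)
      (EuclideanSpace.single j 1) := by
    intro i j
    unfold hessY
    rw [fderiv_clm_apply (contDiff_fderiv_diff hf y) (differentiableAt_const _)]
    simp
  unfold Lop Lfree
  congr 1
  · congr 1
    simp_rw [hh]
    set B := fderiv ℝ (fderiv ℝ (w t)) y
    have : ∀ k, B (colV (σ y) k) (colV (σ y) k) = ∑ i, ∑ j, σ y i k * σ y j k *
        B (EuclideanSpace.single i 1) (EuclideanSpace.single j 1) := by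
      intro k
      conv_lhs => rw [euc_sum (colV (σ y) k)]
      simp only [map_sum, map_smul, ContinuousLinearMap.sum_apply, ContinuousLinearMap.smul_apply,
        smul_eq_mul, Finset.mul_sum]
      rw [Finset.sum_comm]
      refine Finset.sum_congr rfl fun i _ => Finset.sum_congr rfl fun j _ => ?_
      simp only [colV]
      ring
    simp_rw [this, Finset.sum_mul]
    rw [Finset.sum_comm' (t' := Finset.univ) (s' := fun _ => Finset.univ) (by simp)]
    conv_rhs => rw [Finset.sum_comm]
    rw [Finset.sum_comm]
    refine Finset.sum_congr rfl fun i _ => ?_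
    rw [Finset.sum_comm]
  · unfold gradY
    conv_rhs => rw [euc_sum (b y)]
    simp

lemma fderiv2_nonneg {d : ℕ} {f : Euc d → ℝ} (hf : ContDiff ℝ 2 f) {y : Euc d}
    (hmin : IsLocalMin f y) (z : Euc d) : 0 ≤ fderiv ℝ (fderiv ℝ f) y z z := by
  have hd1 : ∀ s : ℝ, HasDerivAt (fun s : ℝ => f (y + s • z)) (fderiv ℝ f (y + s • z) z) s := by
    intro s
    have h1 : HasDerivAt (fun s : ℝ => y + s • z) z s := by
      simpa using ((hasDerivAt_id s).smul_const z).const_add y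
    exact ((hf.differentiable (by norm_num)) (y + s • z)).hasFDerivAt.comp_hasDerivAt s h1
  have hder : deriv (fun s : ℝ => f (y + s • z)) = fun s => fderiv ℝ f (y + s • z) z :=
    funext fun s => (hd1 s).deriv
  have hd2 : HasDerivAt (fun s : ℝ => fderiv ℝ f (y + s • z) z)
      (fderiv ℝ (fderiv ℝ f) y z z) 0 := by
    have h1 : HasDerivAt (fun s : ℝ => y + s • z) z 0 := by
      simpa using ((hasDerivAt_id (0:ℝ)).smul_const z).const_add y
    have h2 : HasFDerivAt (fderiv ℝ f) (fderiv ℝ (fderiv ℝ f) y) (y + (0:ℝ) • z) := by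
      simpa using (contDiff_fderiv_diff hf y).hasFDerivAt
    have h3 := h2.comp_hasDerivAt (0:ℝ) h1
    simpa using h3.clm_apply (hasDerivAt_const (0:ℝ) z)
  have hcont : Continuous (fun s : ℝ => y + s • z) := by fun_prop
  have hminl : IsLocalMin (fun s : ℝ => f (y + s • z)) 0 := by
    have h0 : Filter.Tendsto (fun s : ℝ => y + s • z) (nhds 0) (nhds y) := by
      have := hcont.tendsto 0
      simpa using this
    have := h0.eventually hmin
    simpa [IsLocalMin, IsMinFilter] using this
  by_contra hneg
  push Not at hneg
  have hmaxl : IsLocalMax (fun s : ℝ => f (y + s • z)) 0 := by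
    apply isLocalMax_of_deriv_deriv_neg
    · rw [hder, hd2.deriv]; exact hneg
    · exact hminl.deriv_eq_zero
    · exact (hd1 0).continuousAt
  have hc : (fun s : ℝ => f (y + s • z)) =ᶠ[nhds 0] fun _ => f (y + (0:ℝ) • z) := by
    filter_upwards [hminl, hmaxl] with s h1 h2
    exact le_antisymm h2 h1
  have h4 := hc.deriv.deriv_eq
  rw [hder, hd2.deriv] at h4
  simp at h4
  linarith

/-- The weight function. -/
def gW {d : ℕ} (m : ℕ) (y : Euc d) : ℝ := (1 + ‖y‖ ^ 2) ^ (m + 2)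

lemma gW_contDiff {d : ℕ} (m : ℕ) : ContDiff ℝ 2 (gW (d := d) m) := by
  unfold gW
  exact (contDiff_const.add (contDiff_norm_sq ℝ)).pow _

lemma gW_fderiv {d : ℕ} (m : ℕ) (y z : Euc d) :
    fderiv ℝ (gW m) y z = (m + 2) * (1 + ‖y‖ ^ 2) ^ (m + 1) * (2 * inner ℝ y z) := by
  have h : HasFDerivAt (fun y : Euc d => 1 + ‖y‖ ^ 2) (2 • innerSL ℝ y) y :=
    ((hasStrictFDerivAt_norm_sq y).hasFDerivAt).const_add 1
  have h2 := h.pow (m + 2)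
  have : fderiv ℝ (gW m) y = _ := h2.fderiv
  rw [this]
  simp

lemma gW_fderiv2 {d : ℕ} (m : ℕ) (y z : Euc d) :
    fderiv ℝ (fderiv ℝ (gW m)) y z z =
      (m + 2) * ((m + 1) * (1 + ‖y‖ ^ 2) ^ m * (2 * inner ℝ y z)) * (2 * inner ℝ y z)
      + (m + 2) * (1 + ‖y‖ ^ 2) ^ (m + 1) * (2 * ‖z‖ ^ 2) := by
  have e1 : fderiv ℝ (fderiv ℝ (gW m)) y z z = fderiv ℝ (fun x => fderiv ℝ (gW m) x z) y z := by
    rw [fderiv_clm_apply (contDiff_fderiv_diff (gW_contDiff m) y) (differentiableAt_const _)]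
    simp
  rw [e1]
  simp_rw [gW_fderiv]
  have h : HasFDerivAt (fun y : Euc d => 1 + ‖y‖ ^ 2) (2 • innerSL ℝ y) y :=
    ((hasStrictFDerivAt_norm_sq y).hasFDerivAt).const_add 1
  have h2 := (h.pow (m + 1)).const_mul ((m : ℝ) + 2)
  have h3 : HasFDerivAt (fun x : Euc d => 2 * inner ℝ x z) ((2 : ℝ) • innerSL ℝ z) y := by
    have : HasFDerivAt (fun x : Euc d => (innerSL ℝ z) x) (innerSL ℝ z) y :=
      (innerSL ℝ z).hasFDerivAt
    have := this.const_mul (2 : ℝ)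
    simpa [real_inner_comm] using this
  have h4 : fderiv ℝ (fun x : Euc d => ((m : ℝ) + 2) * (1 + ‖x‖ ^ 2) ^ (m + 1) *
      (2 * inner ℝ x z)) y = _ := (h2.mul h3).fderiv
  rw [h4]
  simp
  ring

lemma gW_pos {d : ℕ} (m : ℕ) (y : Euc d) : 0 < gW m y := by
  unfold gW; positivity

lemma gW_fderiv_le {d : ℕ} (m : ℕ) (y z : Euc d) :
    fderiv ℝ (gW m) y z ≤ (m + 2) * ‖z‖ * gW m y := by
  rw [gW_fderiv]
  have h1 := real_inner_le_norm y z
  have h2 : 2 * ‖y‖ ≤ 1 + ‖y‖ ^ 2 := by nlinarith [sq_nonneg (‖y‖ - 1)]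
  have h3 : 2 * inner ℝ y z ≤ (1 + ‖y‖ ^ 2) * ‖z‖ := by
    nlinarith [norm_nonneg z, mul_le_mul_of_nonneg_right h2 (norm_nonneg z)]
  calc _ ≤ (m + 2) * (1 + ‖y‖ ^ 2) ^ (m + 1) * ((1 + ‖y‖ ^ 2) * ‖z‖) := by gcongr
    _ = _ := by unfold gW; ring

lemma gW_fderiv2_le {d : ℕ} (m : ℕ) (y z : Euc d) :
    fderiv ℝ (fderiv ℝ (gW m)) y z z ≤ ((m + 2) * (m + 1) + 2 * (m + 2)) * ‖z‖ ^ 2 * gW m y := by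
  rw [gW_fderiv2]
  have h1 := abs_real_inner_le_norm y z
  have h2 : 2 * ‖y‖ ≤ 1 + ‖y‖ ^ 2 := by nlinarith [sq_nonneg (‖y‖ - 1)]
  have h3 : |2 * inner ℝ y z| ≤ (1 + ‖y‖ ^ 2) * ‖z‖ := by
    rw [abs_mul, abs_two]
    nlinarith [norm_nonneg z, mul_le_mul_of_nonneg_right h2 (norm_nonneg z)]
  have h4 : (2 * inner ℝ y z) ^ 2 ≤ ((1 + ‖y‖ ^ 2) * ‖z‖) ^ 2 := sq_le_sq' (abs_le.1 h3).1 (abs_le.1 h3).2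
  have h5 : (1 + ‖y‖ ^ 2) ^ (m + 1) ≤ (1 + ‖y‖ ^ 2) ^ (m + 2) :=
    pow_le_pow_right₀ (by nlinarith [sq_nonneg ‖y‖]) (by omega)
  calc _ = ((m:ℝ) + 2) * (m + 1) * (1 + ‖y‖ ^ 2) ^ m * (2 * inner ℝ y z) ^ 2 +
        (m + 2) * (1 + ‖y‖ ^ 2) ^ (m + 1) * (2 * ‖z‖ ^ 2) := by ring
    _ ≤ ((m:ℝ) + 2) * (m + 1) * (1 + ‖y‖ ^ 2) ^ m * ((1 + ‖y‖ ^ 2) * ‖z‖) ^ 2 +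
        (m + 2) * (1 + ‖y‖ ^ 2) ^ (m + 2) * (2 * ‖z‖ ^ 2) := by gcongr
    _ = _ := by unfold gW; ring

lemma Lfree_gW_le {d n : ℕ} (m : ℕ) (b : Euc d → Euc d) (σ : Euc d → Matrix (Fin d) (Fin n) ℝ)
    (hbBdd : ∃ C, ∀ y, ‖b y‖ ≤ C) (hσBdd : ∃ C, ∀ y i k, |σ y i k| ≤ C) :
    ∃ K : ℝ, ∀ y, Lfree (b y) (σ y) (gW m) y ≤ K * gW m y := by
  obtain ⟨Cb, hCb⟩ := hbBdd
  obtain ⟨Cs, hCs⟩ := hσBdd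
  refine ⟨(1/2) * ∑ k : Fin n, (((m:ℝ) + 2) * (m + 1) + 2 * (m + 2)) * (d * Cs ^ 2)
    + (m + 2) * Cb, fun y => ?_⟩
  have hcol : ∀ k, ‖colV (σ y) k‖ ^ 2 ≤ d * Cs ^ 2 := by
    intro k
    rw [EuclideanSpace.norm_sq_eq]
    calc _ ≤ ∑ i : Fin d, Cs ^ 2 := by
          refine Finset.sum_le_sum fun i _ => ?_
          simp only [colV, Real.norm_eq_abs]
          have := hCs y i k
          gcongr
      _ = _ := by simp
  have hg := gW_pos m y
  unfold Lfree
  rw [add_mul, mul_assoc, Finset.sum_mul]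
  gcongr with k
  · exact (gW_fderiv2_le m y _).trans (by gcongr; exact hcol k)
  · exact (gW_fderiv_le m y _).trans (by gcongr; exact hCb y)

lemma Lfree_comb {d n : ℕ} (b : Euc d) (A : Matrix (Fin d) (Fin n) ℝ) {f₁ f₂ g : Euc d → ℝ}
    (c : ℝ) (y : Euc d)
    (h₁ : ContDiff ℝ 2 f₁) (h₂ : ContDiff ℝ 2 f₂) (hg : ContDiff ℝ 2 g) :
    Lfree b A (fun x => f₁ x - f₂ x + c * g x) y =
      Lfree b A f₁ y - Lfree b A f₂ y + c * Lfree b A g y := by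
  have e1 : fderiv ℝ (fun x => f₁ x - f₂ x + c * g x) =
      fun x => fderiv ℝ f₁ x - fderiv ℝ f₂ x + c • fderiv ℝ g x := by
    funext x
    have a1 := (h₁.differentiable (by norm_num) x).hasFDerivAt
    have a2 := (h₂.differentiable (by norm_num) x).hasFDerivAt
    have a3 := (hg.differentiable (by norm_num) x).hasFDerivAt
    exact ((a1.sub a2).add (a3.const_mul c)).fderiv
  have e2 : fderiv ℝ (fderiv ℝ (fun x => f₁ x - f₂ x + c * g x)) y =
      fderiv ℝ (fderiv ℝ f₁) y - fderiv ℝ (fderiv ℝ f₂) y + c • fderiv ℝ (fderiv ℝ g) y := by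
    rw [e1]
    have a1 := (contDiff_fderiv_diff h₁ y).hasFDerivAt
    have a2 := (contDiff_fderiv_diff h₂ y).hasFDerivAt
    have a3 := (contDiff_fderiv_diff hg y).hasFDerivAt
    exact ((a1.sub a2).add (a3.const_smul c)).fderiv
  unfold Lfree
  rw [e2, e1]
  simp only [ContinuousLinearMap.add_apply, ContinuousLinearMap.sub_apply,
    ContinuousLinearMap.smul_apply, smul_eq_mul, Finset.sum_add_distrib, Finset.sum_sub_distrib,
    ← Finset.mul_sum]
  ring

lemma Lfree_nonneg {d n : ℕ} (b : Euc d) (A : Matrix (Fin d) (Fin n) ℝ) {f : Euc d → ℝ}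
    (hf : ContDiff ℝ 2 f) {y : Euc d} (hmin : IsLocalMin f y) : 0 ≤ Lfree b A f y := by
  unfold Lfree
  rw [hmin.fderiv_eq_zero]
  have := Finset.sum_nonneg fun k (_ : k ∈ Finset.univ) =>
    fderiv2_nonneg hf hmin (colV A k)
  simp only [ContinuousLinearMap.zero_apply]
  linarith

lemma right_deriv_nonneg {f : ℝ → ℝ} {f' t s : ℝ} (hts : t < s)
    (hf : HasDerivWithinAt f f' (Set.Icc t s) t) (hmin : ∀ r ∈ Set.Icc t s, f t ≤ f r) :
    0 ≤ f' := by
  have h1 : HasDerivWithinAt f f' (Set.Ioi t) t := by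
    have : HasDerivWithinAt f f' (Set.Ioc t s) t := hf.mono Set.Ioc_subset_Icc_self
    exact this.mono_of_mem_nhdsWithin (Ioc_mem_nhdsGT hts)
  rw [hasDerivWithinAt_iff_tendsto_slope' (by simp)] at h1
  refine ge_of_tendsto h1 ?_
  filter_upwards [Ioc_mem_nhdsGT hts] with r hr
  rw [slope_def_field]
  exact div_nonneg (by linarith [hmin r ⟨hr.1.le, hr.2⟩]) (by linarith [hr.1])

lemma shifted_comparison
    (d n : ℕ) (T p θ κ₀ : ℝ) (hp : 1 < p) (hθ : 0 ≤ θ) (hκ₀ : 0 < κ₀)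
    (b : Euc d → Euc d) (σ : Euc d → Matrix (Fin d) (Fin n) ℝ)
    (hbBdd : ∃ C, ∀ y, ‖b y‖ ≤ C)
    (hσBdd : ∃ C, ∀ y i k, |σ y i k| ≤ C)
    (η lam gam : Euc d → ℝ)
    (hηκ : ∀ y, κ₀ ≤ η y)
    (hgam0 : ∀ y, 0 ≤ gam y)
    (v₁ v₂ : ℝ → Euc d → ℝ)
    (h₁0 : ∀ t ∈ Set.Ico (0 : ℝ) T, ∀ y, 0 ≤ v₁ t y)
    (h₁C12 : IsC12On (Set.Ico 0 T) v₁) (h₂C12 : IsC12On (Set.Ico 0 T) v₂)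
    (h₂PG : PolyGrowthOn 0 T v₂)
    (h₁pde : ∀ t ∈ Set.Ico (0 : ℝ) T, ∀ y,
      partialT (Set.Ico 0 T) v₁ t y + Lop b σ v₁ t y + hjbF p θ η lam gam y (v₁ t y) = 0)
    (h₂pde : ∀ t ∈ Set.Ico (0 : ℝ) T, ∀ y,
      partialT (Set.Ico 0 T) v₂ t y + Lop b σ v₂ t y + hjbF p θ η lam gam y (v₂ t y) = 0)
    (h₁blow : BlowsUpLocUnif 0 T v₁)
    (δ : ℝ) (hδ : 0 < δ) (t : ℝ) (ht : 0 ≤ t) (htδ : t + δ < T) (y : Euc d) :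
    v₂ t y ≤ v₁ (t + δ) y := by
  obtain ⟨C, hC, q, hq, hgrow⟩ := h₂PG (T - δ) (by linarith) (by linarith)
  obtain ⟨K, hK⟩ := Lfree_gW_le q b σ hbBdd hσBdd
  -- main estimate
  suffices hmain : ∀ ε > 0, 0 ≤ v₁ (t + δ) y - v₂ t y + ε * Real.exp (-(K + 1) * t) * gW q y by
    by_contra hlt
    push Not at hlt
    have hpos : 0 < Real.exp (-(K + 1) * t) * gW q y := mul_pos (Real.exp_pos _) (gW_pos _ _)
    have := hmain ((v₂ t y - v₁ (t + δ) y) / 2 / (Real.exp (-(K + 1) * t) * gW q y))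
      (div_pos (by linarith) hpos)
    rw [mul_assoc, div_mul_cancel₀ _ hpos.ne'] at this
    linarith
  intro ε hε
  by_contra hneg
  push Not at hneg
  -- lower bound for the exponential on `[0,T]`
  obtain ⟨c, hc, hexp⟩ : ∃ c > 0, ∀ r ∈ Set.Icc 0 T, c ≤ ε * Real.exp (-(K + 1) * r) := by
    refine ⟨ε * Real.exp (-(|K + 1| * T)), by positivity, fun r hr => ?_⟩
    gcongr
    have h1 : (K + 1) * r ≤ |K + 1| * T :=
      mul_le_mul (le_abs_self _) hr.2 hr.1 (abs_nonneg _)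
    linarith
  set R : ℝ := ‖y‖ + 1 + 2 * C / c with hR
  have hCc : 0 < 2 * C / c := by positivity
  have hR1 : 1 ≤ R := by have := norm_nonneg y; linarith
  have hyR : ‖y‖ ≤ R := by linarith
  set W : ℝ → Euc d → ℝ := fun r x =>
    v₁ (r + δ) x - v₂ r x + ε * Real.exp (-(K + 1) * r) * gW q x with hW
  have hout : ∀ r, 0 ≤ r → r + δ < T → ∀ x : Euc d, R ≤ ‖x‖ → 0 < W r x := by
    intro r hr hrT x hx
    have a1 := h₁0 (r + δ) ⟨by linarith, hrT⟩ x
    have a2 := (le_abs_self _).trans (hgrow r hr (by linarith) x)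
    have a3 := hexp r ⟨hr, by linarith⟩
    have hx0 := norm_nonneg x
    have a4 : ‖x‖ ^ q ≤ (1 + ‖x‖ ^ 2) ^ q := by
      gcongr
      nlinarith [sq_nonneg (‖x‖ - 1)]
    have a5 : 1 ≤ (1 + ‖x‖ ^ 2) ^ q := one_le_pow₀ (by nlinarith [sq_nonneg ‖x‖])
    have a6 : 2 * C < c * (1 + ‖x‖ ^ 2) := by
      have : 2 * C / c ≤ ‖x‖ ^ 2 := by
        have : 2 * C / c ≤ ‖x‖ := by have := norm_nonneg y; linarith
        nlinarith
      rw [div_le_iff₀ hc] at this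
      nlinarith
    have a7 : (1 + ‖x‖ ^ 2) ^ q * (1 + ‖x‖ ^ 2) ≤ gW q x := by
      unfold gW
      rw [← pow_succ]
      exact pow_le_pow_right₀ (by nlinarith [sq_nonneg ‖x‖]) (by omega)
    have a8 : C * (1 + ‖x‖ ^ q) < c * gW q x := by
      calc C * (1 + ‖x‖ ^ q) ≤ C * (2 * (1 + ‖x‖ ^ 2) ^ q) := by gcongr; linarith
        _ = (1 + ‖x‖ ^ 2) ^ q * (2 * C) := by ring
        _ < (1 + ‖x‖ ^ 2) ^ q * (c * (1 + ‖x‖ ^ 2)) := by gcongr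
        _ = c * ((1 + ‖x‖ ^ 2) ^ q * (1 + ‖x‖ ^ 2)) := by ring
        _ ≤ _ := by gcongr
    have a9 := mul_le_mul_of_nonneg_right a3 (gW_pos q x).le
    simp only [hW]
    linarith
  obtain ⟨t₀, ht₀0, ht₀T, hbl⟩ := h₁blow (Metric.closedBall 0 R)
    (isCompact_closedBall _ _) (C * (1 + R ^ q) + 1)
  set s : ℝ := max t (t₀ - δ) with hs
  have hsT : s + δ < T := by
    rcases max_cases t (t₀ - δ) with h | h <;> rw [hs, h.1] <;> linarith
  have hs0 : 0 ≤ s := ht.trans (le_max_left _ _)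
  have hend : ∀ x : Euc d, ‖x‖ ≤ R → 0 < W s x := by
    intro x hx
    have a1 := hbl (s + δ) (by linarith [le_max_right t (t₀ - δ)]) hsT x (by simpa using hx)
    have a2 := (le_abs_self _).trans (hgrow s hs0 (by linarith) x)
    have a3 : C * (1 + ‖x‖ ^ q) ≤ C * (1 + R ^ q) := by gcongr
    have a4 : 0 < ε * Real.exp (-(K + 1) * s) * gW q x :=
      mul_pos (mul_pos hε (Real.exp_pos _)) (gW_pos q x)
    simp only [hW]
    linarith
  have hWc : ContinuousOn (fun z : ℝ × Euc d => W z.1 z.2)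
      (Set.Icc 0 s ×ˢ Metric.closedBall (0 : Euc d) R) := by
    simp only [hW]
    refine ContinuousOn.add (ContinuousOn.sub ?_ ?_) ?_
    · refine h₁C12.2.2.1.comp (f := fun z : ℝ × Euc d => (z.1 + δ, z.2)) (by fun_prop) ?_
      rintro ⟨r, x⟩ ⟨hr, -⟩
      exact ⟨⟨by linarith [hr.1], by linarith [hr.2]⟩, trivial⟩
    · refine h₂C12.2.2.1.mono ?_
      rintro ⟨r, x⟩ ⟨hr, -⟩
      exact ⟨⟨by linarith [hr.1], by linarith [hr.2]⟩, trivial⟩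
    · have := (gW_contDiff (d := d) q).continuous
      exact Continuous.continuousOn (by fun_prop)
  obtain ⟨⟨τ, x⟩, ⟨hτ, hx⟩, hmin⟩ := (isCompact_Icc.prod (isCompact_closedBall (0 : Euc d) R)).exists_isMinOn
    ⟨(0, 0), ⟨le_refl _, hs0⟩, by simp; linarith⟩ hWc
  simp only at hτ hx
  have hmin' : ∀ r ∈ Set.Icc 0 s, ∀ z : Euc d, ‖z‖ ≤ R → W τ x ≤ W r z := fun r hr z hz =>
    hmin (show (r, z) ∈ _ from ⟨hr, by simpa using hz⟩)
  have hxR : ‖x‖ ≤ R := by simpa using hx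
  have hWneg : W τ x < 0 := (hmin' t ⟨ht, le_max_left _ _⟩ y hyR).trans_lt hneg
  have hτs : τ < s := by
    rcases hτ.2.eq_or_lt with h | h
    · have := hend x hxR
      rw [← h] at this; linarith
    · exact h
  have hτT : τ + δ < T := by linarith
  have hxR' : ‖x‖ < R := by
    by_contra h
    have := hout τ hτ.1 hτT x (not_lt.1 h)
    linarith
  have m1 : τ + δ ∈ Set.Ico 0 T := ⟨by linarith [hτ.1], hτT⟩
  have m2 : τ ∈ Set.Ico 0 T := ⟨hτ.1, by linarith⟩
  -- spatial condition
  have c1 := h₁C12.2.1 _ m1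
  have c2 := h₂C12.2.1 _ m2
  have hloc : IsLocalMin (W τ) x := by
    have : Metric.ball (0 : Euc d) R ∈ nhds x := Metric.isOpen_ball.mem_nhds (by simpa using hxR')
    filter_upwards [this] with z hz
    exact hmin' τ hτ z (by simpa using (Metric.mem_ball.1 hz).le)
  have hWC : ContDiff ℝ 2 (W τ) := (c1.sub c2).add (contDiff_const.mul (gW_contDiff q))
  have hL := Lfree_nonneg (b x) (σ x) hWC hloc
  have hL' := Lfree_comb (b x) (σ x) (ε * Real.exp (-(K + 1) * τ)) x c1 c2 (gW_contDiff q)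
  change Lfree (b x) (σ x) (W τ) x = _ at hL'
  rw [hL'] at hL
  -- time condition
  have d1 : HasDerivWithinAt (fun r => v₁ (r + δ) x) (partialT (Set.Ico 0 T) v₁ (τ + δ) x)
      (Set.Icc τ s) τ := by
    have h := (h₁C12.1 _ m1 x).hasDerivWithinAt
    have h2 : HasDerivWithinAt (fun r : ℝ => r + δ) 1 (Set.Icc τ s) τ :=
      (hasDerivWithinAt_id _ _).add_const δ
    have hmaps : Set.MapsTo (fun r : ℝ => r + δ) (Set.Icc τ s) (Set.Ico 0 T) := fun r hr =>
      ⟨by linarith [hr.1, hτ.1], by linarith [hr.2]⟩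
    have h3 := HasDerivWithinAt.comp τ h h2 hmaps
    simpa [partialT, Function.comp_def] using h3
  have d2 : HasDerivWithinAt (fun r => v₂ r x) (partialT (Set.Ico 0 T) v₂ τ x)
      (Set.Icc τ s) τ :=
    (h₂C12.1 _ m2 x).hasDerivWithinAt.mono (fun r hr =>
      ⟨by linarith [hr.1, hτ.1], by linarith [hr.2]⟩)
  have d3 : HasDerivWithinAt (fun r => ε * Real.exp (-(K + 1) * r) * gW q x)
      (-(K + 1) * (ε * Real.exp (-(K + 1) * τ)) * gW q x) (Set.Icc τ s) τ := by
    have h : HasDerivAt (fun r : ℝ => -(K + 1) * r) (-(K + 1)) τ := by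
      simpa using (hasDerivAt_id τ).const_mul (-(K + 1))
    have := ((h.exp.const_mul ε).mul_const (gW q x)).hasDerivWithinAt (s := Set.Icc τ s)
    exact this.congr_deriv (by ring)
  have hD := right_deriv_nonneg hτs ((d1.sub d2).add d3) (fun r hr =>
    hmin' r ⟨hτ.1.trans hr.1, hr.2⟩ x hxR)
  -- combine
  have hE : 0 < ε * Real.exp (-(K + 1) * τ) := mul_pos hε (Real.exp_pos _)
  have hg := gW_pos q x
  have hle : v₁ (τ + δ) x ≤ v₂ τ x := by
    have := mul_pos hE hg
    simp only [hW] at hWneg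
    linarith
  have hF := hjbF_anti p θ hp hθ η lam gam x (hκ₀.trans_le (hηκ x)) (hgam0 x) _ _
    (h₁0 _ m1 x) hle
  have p1 := h₁pde _ m1 x
  have p2 := h₂pde _ m2 x
  rw [Lop_eq b σ v₁ _ x c1] at p1
  rw [Lop_eq b σ v₂ _ x c2] at p2
  have hKx := mul_le_mul_of_nonneg_left (hK x) hE.le
  have := mul_pos hE hg
  nlinarith

lemma one_sided
    (d n : ℕ) (T p θ κ₀ : ℝ) (hp : 1 < p) (hθ : 0 ≤ θ) (hκ₀ : 0 < κ₀)
    (b : Euc d → Euc d) (σ : Euc d → Matrix (Fin d) (Fin n) ℝ)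
    (hbBdd : ∃ C, ∀ y, ‖b y‖ ≤ C)
    (hσBdd : ∃ C, ∀ y i k, |σ y i k| ≤ C)
    (η lam gam : Euc d → ℝ)
    (hηκ : ∀ y, κ₀ ≤ η y)
    (hgam0 : ∀ y, 0 ≤ gam y)
    (v₁ v₂ : ℝ → Euc d → ℝ)
    (h₁0 : ∀ t ∈ Set.Ico (0 : ℝ) T, ∀ y, 0 ≤ v₁ t y)
    (h₁C12 : IsC12On (Set.Ico 0 T) v₁) (h₂C12 : IsC12On (Set.Ico 0 T) v₂)
    (h₂PG : PolyGrowthOn 0 T v₂)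
    (h₁pde : ∀ t ∈ Set.Ico (0 : ℝ) T, ∀ y,
      partialT (Set.Ico 0 T) v₁ t y + Lop b σ v₁ t y + hjbF p θ η lam gam y (v₁ t y) = 0)
    (h₂pde : ∀ t ∈ Set.Ico (0 : ℝ) T, ∀ y,
      partialT (Set.Ico 0 T) v₂ t y + Lop b σ v₂ t y + hjbF p θ η lam gam y (v₂ t y) = 0)
    (h₁blow : BlowsUpLocUnif 0 T v₁)
    (t : ℝ) (ht : t ∈ Set.Ico (0 : ℝ) T) (y : Euc d) :
    v₂ t y ≤ v₁ t y := by
  have hc : ContinuousWithinAt (fun r => v₁ r y) (Set.Ico 0 T) t :=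
    (h₁C12.1 t ht y).continuousWithinAt
  have hc2 : Filter.Tendsto (fun r => v₁ r y) (nhdsWithin t (Set.Ioi t)) (nhds (v₁ t y)) := by
    refine hc.tendsto.mono_left ?_
    refine nhdsWithin_le_of_mem ?_
    filter_upwards [Ioo_mem_nhdsGT ht.2] with r hr
    exact ⟨ht.1.trans hr.1.le, hr.2⟩
  refine ge_of_tendsto hc2 ?_
  filter_upwards [Ioo_mem_nhdsGT ht.2] with r hr
  have := shifted_comparison d n T p θ κ₀ hp hθ hκ₀ b σ hbBdd hσBdd η lam gam hηκ hgam0 v₁ v₂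
    h₁0 h₁C12 h₂C12 h₂PG h₁pde h₂pde h₁blow (r - t) (by linarith [hr.1]) t ht.1
    (by linarith [hr.2]) y
  simpa using this

/-- uniqueness, from Proposition 3.1: there is at most one nonnegative
`C^{1,2}` solution of polynomial growth to the singular terminal value problem. -/
theorem singular_terminal_value_uniqueness
    (d n : ℕ) (hd : 1 ≤ d) (hn : 1 ≤ n)
    (T p θ κ₀ : ℝ) (hT : 0 < T) (hp : 1 < p) (hθ : 0 ≤ θ) (hκ₀ : 0 < κ₀)
    (b : Euc d → Euc d) (σ : Euc d → Matrix (Fin d) (Fin n) ℝ)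
    (hbLip : ∃ K : ℝ≥0, LipschitzWith K b) (hbBdd : ∃ C, ∀ y, ‖b y‖ ≤ C)
    (hσLip : ∃ K, ∀ y y' : Euc d, ∀ i k, |σ y i k - σ y' i k| ≤ K * ‖y - y'‖)
    (hσBdd : ∃ C, ∀ y i k, |σ y i k| ≤ C)
    (hell : ∃ ν > 0, ∀ (y : Euc d) (z : Fin d → ℝ),
      ν * ∑ i, z i ^ 2 ≤ ∑ i, ∑ j, (∑ k, σ y i k * σ y j k) * z j * z i)
    (η lam gam : Euc d → ℝ)
    (hηC2 : ContDiff ℝ 2 η)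
    (hηBdd : ∃ C, ∀ y, |η y| ≤ C ∧ ‖fderiv ℝ η y‖ ≤ C ∧ ‖fderiv ℝ (fderiv ℝ η) y‖ ≤ C)
    (hηκ : ∀ y, κ₀ ≤ η y)
    (hlamCont : Continuous lam) (hlam0 : ∀ y, 0 ≤ lam y) (hlamBdd : ∃ C, ∀ y, lam y ≤ C)
    (hgamCont : Continuous gam) (hgam0 : ∀ y, 0 ≤ gam y) (hgamBdd : ∃ C, ∀ y, gam y ≤ C)
    (v₁ v₂ : ℝ → Euc d → ℝ)
    (h₁0 : ∀ t ∈ Set.Ico (0 : ℝ) T, ∀ y, 0 ≤ v₁ t y)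
    (h₂0 : ∀ t ∈ Set.Ico (0 : ℝ) T, ∀ y, 0 ≤ v₂ t y)
    (h₁C12 : IsC12On (Set.Ico 0 T) v₁) (h₂C12 : IsC12On (Set.Ico 0 T) v₂)
    (h₁PG : PolyGrowthOn 0 T v₁) (h₂PG : PolyGrowthOn 0 T v₂)
    (h₁pde : ∀ t ∈ Set.Ico (0 : ℝ) T, ∀ y,
      partialT (Set.Ico 0 T) v₁ t y + Lop b σ v₁ t y + hjbF p θ η lam gam y (v₁ t y) = 0)
    (h₂pde : ∀ t ∈ Set.Ico (0 : ℝ) T, ∀ y,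
      partialT (Set.Ico 0 T) v₂ t y + Lop b σ v₂ t y + hjbF p θ η lam gam y (v₂ t y) = 0)
    (h₁blow : BlowsUpLocUnif 0 T v₁) (h₂blow : BlowsUpLocUnif 0 T v₂) :
    ∀ t ∈ Set.Ico (0 : ℝ) T, ∀ y, v₁ t y = v₂ t y := by
  intro t ht y
  exact le_antisymm
    (one_sided d n T p θ κ₀ hp hθ hκ₀ b σ hbBdd hσBdd η lam gam hηκ hgam0 v₂ v₁
      h₂0 h₂C12 h₁C12 h₁PG h₂pde h₁pde h₂blow t ht y)
    (one_sided d n T p θ κ₀ hp hθ hκ₀ b σ hbBdd hσBdd η lam gam hηκ hgam0 v₁ v₂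
      h₁0 h₁C12 h₂C12 h₂PG h₁pde h₂pde h₁blow t ht y)
end
end

section
/- Separation of the singularity (Lemma 3.5): let δ ∈ (0,T] and suppose u : [0,δ]×ℝ^d → ℝ is continuous, is C^{1,2} on (0,δ]×ℝ^d, satisfies |u(t,y)| ≤ t η(y) for all (t,y) ∈ [0,δ]×ℝ^d, and solves equation (⋆) on (0,δ]×ℝ^d. Then the function v(t,y) := η(y)(T−t)^{−1/β} + u(T−t, y)(T−t)^{−1−1/β} is nonnegative, C^{1,2} on [T−δ, T)×ℝ^d, and satisfies v_t + Lv + F(y,v) = 0 there. If in addition there is R > 0 with |u(t,y)| ≤ R t² for all (t,y), then v(t,y) → +∞ as t → T uniformly in y. -/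
open scoped BigOperators NNReal

noncomputable section

/-- Generalized binomial coefficient `binom(α,k) = (∏_{i=0}^{k−1}(α−i))/k!`. -/
noncomputable def rbinom (α : ℝ) (k : ℕ) : ℝ :=
  (∏ i ∈ Finset.range k, (α - i)) / (Nat.factorial k : ℝ)

/-- Equation (⋆) on `(0,δ] × ℝ^d`, with `β = 1/(p−1)`, `1/β = p−1`, `β+1 = 1/(p−1)+1`;
by Lean's conventions the quotient term is `0` when its denominator vanishes, and the
binomial series starts from `k = 2`. -/
def SolvesStar {d n : ℕ} (p θ δ : ℝ) (b : Euc d → Euc d)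
    (σ : Euc d → Matrix (Fin d) (Fin n) ℝ) (η lam gam : Euc d → ℝ)
    (u : ℝ → Euc d → ℝ) : Prop :=
  ∀ t ∈ Set.Ioc (0 : ℝ) δ, ∀ y : Euc d,
    partialT (Set.Ioc 0 δ) u t y =
      Lop b σ u t y + t * Lop b σ (fun _ => η) 0 y + t ^ p * lam y
        - (η y / (1 / (p - 1))) *
            ∑' k : ℕ, rbinom (1 / (p - 1) + 1) (k + 2) * (u t y / (t * η y)) ^ (k + 2)
        + θ * t ^ p * gam y * (t * η y + u t y) /
            ((t ^ p * gam y) ^ (1 / (p - 1)) + |t * η y + u t y| ^ (1 / (p - 1))) ^ (p - 1)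
        - θ * (t * η y + u t y)

/-- The candidate solution `v(t,y) = η(y)(T−t)^{−1/β} + u(T−t,y)(T−t)^{−1−1/β}`, where
`−1/β = −(p−1)` and `−1−1/β = −p`. -/
noncomputable def sepV {d : ℕ} (T p : ℝ) (η : Euc d → ℝ) (u : ℝ → Euc d → ℝ)
    (t : ℝ) (y : Euc d) : ℝ :=
  η y * (T - t) ^ (-(p - 1)) + u (T - t) y * (T - t) ^ (-p)

lemma rbinom_eq_choose (a : ℝ) (k : ℕ) : rbinom a k = Ring.choose a k := by
  rw [Ring.choose_eq_smul, rbinom]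
  have : (descPochhammer ℤ k).smeval a = ∏ i ∈ Finset.range k, (a - i) := by
    induction k with
    | zero => simp
    | succ n ih =>
      rw [descPochhammer_succ_right, Polynomial.smeval_mul, ih, Finset.prod_range_succ]
      simp [Polynomial.smeval_natCast]
  rw [this, smul_eq_mul]
  field_simp

lemma rbinom_succ (a : ℝ) (k : ℕ) : (k + 1) * rbinom a (k + 1) = (a - k) * rbinom a k := by
  unfold rbinom
  rw [Finset.prod_range_succ, Nat.factorial_succ]
  have : (Nat.factorial k : ℝ) ≠ 0 := by positivity
  push_cast
  field_simp

lemma summable_abs_rbinom (a : ℝ) (ha : 0 < a) : Summable (fun k => |rbinom a k|) := by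
  obtain ⟨N, hN⟩ := exists_nat_gt a
  rw [← summable_nat_add_iff N]
  have key : ∀ n : ℕ, a * ∑ k ∈ Finset.range n, |rbinom a (k + N)|
      = N * |rbinom a N| - (n + N : ℕ) * |rbinom a (n + N)| := by
    intro n
    induction n with
    | zero => simp
    | succ m ih =>
      rw [Finset.sum_range_succ, mul_add, ih]
      have h := congrArg abs (rbinom_succ a (m + N))
      rw [abs_mul, abs_mul, abs_of_nonneg (by positivity : (0 : ℝ) ≤ ((m + N : ℕ) : ℝ) + 1),
        abs_of_neg (a := a - ((m + N : ℕ) : ℝ)) (by push_cast; nlinarith [(m.cast_nonneg : (0 : ℝ) ≤ m)])] at h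
      rw [show m + 1 + N = m + N + 1 by ring]
      push_cast at h ⊢
      linarith
  refine summable_of_sum_range_le (c := N * |rbinom a N| / a) (fun _ => abs_nonneg _) (fun n => ?_)
  rw [le_div_iff₀ ha, mul_comm, key]
  have : 0 ≤ ((n + N : ℕ) : ℝ) * |rbinom a (n + N)| := by positivity
  linarith

lemma tsum_rbinom (a : ℝ) (ha : 0 < a) (x : ℝ) (hx : |x| ≤ 1) :
    ∑' k, rbinom a k * x ^ k = (1 + x) ^ a := by
  have hc : ContinuousOn (fun x : ℝ => ∑' k, rbinom a k * x ^ k) (Set.Icc (-1) 1) := by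
    refine continuousOn_tsum (u := fun k => |rbinom a k|) (fun k => by fun_prop)
      (summable_abs_rbinom a ha) ?_
    intro k y hy
    rw [Real.norm_eq_abs, abs_mul, abs_pow]
    exact mul_le_of_le_one_right (abs_nonneg _) (pow_le_one₀ (abs_nonneg _) (abs_le.2 hy))
  have hc2 : ContinuousOn (fun x : ℝ => (1 + x) ^ a) (Set.Icc (-1) 1) := by
    apply Continuous.continuousOn
    exact Continuous.rpow_const (by fun_prop) (fun _ => Or.inr ha.le)
  have heq : Set.EqOn (fun x : ℝ => ∑' k, rbinom a k * x ^ k) (fun x : ℝ => (1 + x) ^ a)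
      (Set.Ioo (-1) 1) := by
    intro y hy
    have h := (Real.one_add_rpow_hasFPowerSeriesOnBall_zero (a := a)).hasSum (y := y) (by
      rw [← ENNReal.ofReal_one, Metric.eball_ofReal]
      simpa [abs_lt] using hy)
    have h2 := h.tsum_eq
    simp only [zero_add] at h2
    simp only
    rw [← h2]
    refine tsum_congr fun k => ?_
    rw [rbinom_eq_choose, binomialSeries_apply]
    simp [List.ofFn_const]
  have := heq.of_subset_closure hc hc2 Set.Ioo_subset_Icc_self
    (by rw [closure_Ioo (by norm_num)])
  exact this (abs_le.1 hx)

lemma tsum_rbinom_two (a : ℝ) (ha : 0 < a) (x : ℝ) (hx : |x| ≤ 1) :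
    ∑' k, rbinom a (k + 2) * x ^ (k + 2) = (1 + x) ^ a - 1 - a * x := by
  rw [← tsum_rbinom a ha x hx]
  have hs : Summable (fun k => rbinom a k * x ^ k) := by
    refine Summable.of_norm_bounded (summable_abs_rbinom a ha) fun k => ?_
    rw [Real.norm_eq_abs, abs_mul, abs_pow]
    exact mul_le_of_le_one_right (abs_nonneg _) (pow_le_one₀ (abs_nonneg _) hx)
  rw [← hs.sum_add_tsum_nat_add 2]
  simp [Finset.sum_range_succ, rbinom]
  ring

/-- spatial gradient of `η c₁ + w c₂`. -/
lemma fderiv_lin {d : ℕ} {η w : Euc d → ℝ} (hη : ContDiff ℝ 2 η) (hw : ContDiff ℝ 2 w) (c e : ℝ) :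
    (fun z => fderiv ℝ (fun y => η y * c + w y * e) z)
      = fun z => c • fderiv ℝ η z + e • fderiv ℝ w z := by
  funext z
  have h1 : DifferentiableAt ℝ η z := hη.differentiable (by norm_num) z
  have h2 : DifferentiableAt ℝ w z := hw.differentiable (by norm_num) z
  exact ((h1.hasFDerivAt.mul_const c).add (h2.hasFDerivAt.mul_const e)).fderiv

lemma fderiv2_lin {d : ℕ} {η w : Euc d → ℝ} (hη : ContDiff ℝ 2 η) (hw : ContDiff ℝ 2 w) (c e : ℝ)
    (y : Euc d) :
    fderiv ℝ (fun z => fderiv ℝ (fun y => η y * c + w y * e) z) y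
      = c • fderiv ℝ (fun z => fderiv ℝ η z) y + e • fderiv ℝ (fun z => fderiv ℝ w z) y := by
  rw [fderiv_lin hη hw]
  have h1 : DifferentiableAt ℝ (fun z => fderiv ℝ η z) y :=
    (hη.fderiv_right (m := 1) (by norm_num)).differentiable (by norm_num) y
  have h2 : DifferentiableAt ℝ (fun z => fderiv ℝ w z) y :=
    (hw.fderiv_right (m := 1) (by norm_num)).differentiable (by norm_num) y
  exact ((h1.hasFDerivAt.const_smul c).add (h2.hasFDerivAt.const_smul e)).fderiv

lemma hess_apply {d : ℕ} {w : Euc d → ℝ} (hw : ContDiff ℝ 2 w) (y a b : Euc d) :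
    fderiv ℝ (fun z => fderiv ℝ w z a) y b = fderiv ℝ (fun z => fderiv ℝ w z) y b a := by
  have h2 : DifferentiableAt ℝ (fun z => fderiv ℝ w z) y :=
    (hw.fderiv_right (m := 1) (by norm_num)).differentiable (by norm_num) y
  rw [(h2.hasFDerivAt.clm_apply (hasFDerivAt_const a y)).fderiv]
  simp

lemma Lop_lin {d n : ℕ} (b : Euc d → Euc d) (σ : Euc d → Matrix (Fin d) (Fin n) ℝ)
    {η : Euc d → ℝ} {u W : ℝ → Euc d → ℝ} {s t : ℝ} (hη : ContDiff ℝ 2 η)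
    (hw : ContDiff ℝ 2 (u s)) (c e : ℝ) (hW : W t = fun y => η y * c + u s y * e) (y : Euc d) :
    Lop b σ W t y = c * Lop b σ (fun _ => η) 0 y + e * Lop b σ u s y := by
  have hC : ContDiff ℝ 2 (W t) := by rw [hW]; fun_prop
  have hg : ∀ i, gradY W t y i = c * gradY (fun _ => η) 0 y i + e * gradY u s y i := by
    intro i
    unfold gradY
    rw [hW, congrFun (fderiv_lin hη hw c e) y]
    simp
  have hh : ∀ i j, hessY W t y i j = c * hessY (fun _ => η) 0 y i j + e * hessY u s y i j := by
    intro i j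
    unfold hessY
    rw [hess_apply hC, hess_apply hη, hess_apply hw, hW, fderiv2_lin hη hw c e]
    simp
  unfold Lop
  simp only [hg, hh, mul_add, Finset.sum_add_distrib, Finset.mul_sum]
  have e1 : ∀ (A c h : ℝ), 1 / 2 * (A * (c * h)) = c * (1 / 2 * (A * h)) := by intros; ring
  have e2 : ∀ (A c h : ℝ), A * (c * h) = c * (A * h) := by intros; ring
  simp only [e1, e2 (b y _)]
  ring

/-- the algebraic identity -/
lemma key_alg (p θ τ η l g U S X Lη Lu ut : ℝ) (hp : 1 < p) (hτ : 0 < τ) (hη : 0 < η) (hg : 0 ≤ g)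
    (hU : |U| ≤ τ * η)
    (hS : S = (1 + U / (τ * η)) ^ (1 / (p - 1) + 1) - 1 - (1 / (p - 1) + 1) * (U / (τ * η)))
    (hX : X = η * τ ^ (-(p - 1)) + U * τ ^ (-p))
    (hut : ut = Lu + τ * Lη + τ ^ p * l - (η / (1 / (p - 1))) * S
      + θ * τ ^ p * g * (τ * η + U) /
            ((τ ^ p * g) ^ (1 / (p - 1)) + |τ * η + U| ^ (1 / (p - 1))) ^ (p - 1)
        - θ * (τ * η + U)) :
    (η * ((p - 1) * τ ^ (-p)) + (-ut * τ ^ (-p) + U * (p * τ ^ (-p - 1))))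
      + (τ ^ (-(p - 1)) * Lη + τ ^ (-p) * Lu)
      + (l - X ^ (1 / (p - 1) + 1) / ((1 / (p - 1)) * η ^ (1 / (p - 1)))
    + θ * g * X / ((g ^ (1 / (p - 1)) + X ^ (1 / (p - 1))) ^ (p - 1))
    - θ * X) = 0 := by
  have hp1 : 0 < p - 1 := by linarith
  have hq : 0 < τ ^ p := Real.rpow_pos_of_pos hτ p
  have hqi : τ ^ (-p) = (τ ^ p)⁻¹ := Real.rpow_neg hτ.le p
  have hq1 : τ ^ (-(p - 1)) = τ * (τ ^ p)⁻¹ := by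
    rw [neg_sub, sub_eq_add_neg, Real.rpow_add hτ, hqi, Real.rpow_one]
  have hq2 : τ ^ (-p - 1) = (τ ^ p)⁻¹ / τ := by
    rw [Real.rpow_sub hτ, hqi, Real.rpow_one]
  have hWX : τ * η + U = τ ^ p * X := by
    rw [hX, hq1, hqi]; field_simp
  have hW0 : 0 ≤ τ * η + U := by have := (abs_le.1 hU).1; linarith
  have hX0 : 0 ≤ X := by
    by_contra h
    push Not at h
    have := mul_neg_of_pos_of_neg hq h
    linarith
  have hpq : (τ ^ p) ^ (1 / (p - 1)) = τ * τ ^ (1 / (p - 1)) := by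
    rw [← Real.rpow_mul hτ.le, show p * (1 / (p - 1)) = 1 + 1 / (p - 1) by field_simp; ring,
      Real.rpow_add hτ, Real.rpow_one]
  -- the theta quotient
  have hth : θ * τ ^ p * g * (τ * η + U) /
            ((τ ^ p * g) ^ (1 / (p - 1)) + |τ * η + U| ^ (1 / (p - 1))) ^ (p - 1)
      = τ ^ p * (θ * g * X / ((g ^ (1 / (p - 1)) + X ^ (1 / (p - 1))) ^ (p - 1))) := by
    rw [abs_of_nonneg hW0, hWX, Real.mul_rpow hq.le hg, Real.mul_rpow hq.le hX0, ← mul_add,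
      Real.mul_rpow (by positivity) (by positivity), ← Real.rpow_mul hq.le,
      one_div_mul_cancel hp1.ne', Real.rpow_one]
    rw [show θ * τ ^ p * g * (τ ^ p * X) = τ ^ p * (τ ^ p * (θ * g * X)) by ring,
      mul_div_mul_left _ _ hq.ne', mul_div_assoc]
  -- the power
  have h1x : X = (η * τ * (τ ^ p)⁻¹) * (1 + U / (τ * η)) := by
    rw [hX, hq1, hqi]; field_simp
  have hx0 : 0 ≤ 1 + U / (τ * η) := by
    have : 1 + U / (τ * η) = (τ * η + U) / (τ * η) := by field_simp
    rw [this]; positivity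
  have hpow : X ^ (1 / (p - 1) + 1) / ((1 / (p - 1)) * η ^ (1 / (p - 1)))
      = (p - 1) * η * (τ ^ p)⁻¹ * (1 + U / (τ * η)) ^ (1 / (p - 1) + 1) := by
    have hA : (η * τ * (τ ^ p)⁻¹) ^ (1 / (p - 1) + 1) = η ^ (1 / (p - 1)) * η * (τ ^ p)⁻¹ := by
      rw [Real.rpow_add (by positivity), Real.rpow_one, Real.mul_rpow (by positivity) (by positivity),
        Real.mul_rpow (by positivity) (by positivity), Real.inv_rpow hq.le, hpq]
      have : 0 < τ ^ (1 / (p - 1)) := Real.rpow_pos_of_pos hτ _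
      field_simp
    have hB : 0 < η ^ (1 / (p - 1)) := Real.rpow_pos_of_pos hη _
    rw [h1x, Real.mul_rpow (by positivity) hx0, hA]
    field_simp
  rw [hpow, hut, hth, hS, hq1, hqi, hq2]
  generalize θ * g * X / ((g ^ (1 / (p - 1)) + X ^ (1 / (p - 1))) ^ (p - 1)) = Q
  generalize (1 + U / (τ * η)) ^ (1 / (p - 1) + 1) = Z
  rw [hWX]
  generalize τ ^ p = q at *
  field_simp
  ring


/-- Lemma 3.5, separation of the singularity: if `u` is continuous on
`[0,δ] × ℝ^d`, `C^{1,2}` on `(0,δ] × ℝ^d`, satisfies `|u(t,y)| ≤ t η(y)` and solves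
equation (⋆), then `v(t,y) = η(y)(T−t)^{−1/β} + u(T−t,y)(T−t)^{−1−1/β}` is a nonnegative
`C^{1,2}` solution of the HJB PDE on `[T−δ,T) × ℝ^d`; if moreover `|u(t,y)| ≤ R t²`,
then `v(t,y) → +∞` as `t → T` uniformly in `y`. -/
theorem separation_of_singularity
    (d n : ℕ) (hd : 1 ≤ d) (hn : 1 ≤ n)
    (T p θ κ₀ : ℝ) (hT : 0 < T) (hp : 1 < p) (hθ : 0 ≤ θ) (hκ₀ : 0 < κ₀)
    (b : Euc d → Euc d) (σ : Euc d → Matrix (Fin d) (Fin n) ℝ)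
    (hbLip : ∃ K : ℝ≥0, LipschitzWith K b) (hbBdd : ∃ C, ∀ y, ‖b y‖ ≤ C)
    (hσLip : ∃ K, ∀ y y' : Euc d, ∀ i k, |σ y i k - σ y' i k| ≤ K * ‖y - y'‖)
    (hσBdd : ∃ C, ∀ y i k, |σ y i k| ≤ C)
    (hell : ∃ ν > 0, ∀ (y : Euc d) (z : Fin d → ℝ),
      ν * ∑ i, z i ^ 2 ≤ ∑ i, ∑ j, (∑ k, σ y i k * σ y j k) * z j * z i)
    (η lam gam : Euc d → ℝ)
    (hηC2 : ContDiff ℝ 2 η)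
    (hηBdd : ∃ C, ∀ y, |η y| ≤ C ∧ ‖fderiv ℝ η y‖ ≤ C ∧ ‖fderiv ℝ (fderiv ℝ η) y‖ ≤ C)
    (hηκ : ∀ y, κ₀ ≤ η y)
    (hlamCont : Continuous lam) (hlam0 : ∀ y, 0 ≤ lam y) (hlamBdd : ∃ C, ∀ y, lam y ≤ C)
    (hgamCont : Continuous gam) (hgam0 : ∀ y, 0 ≤ gam y) (hgamBdd : ∃ C, ∀ y, gam y ≤ C)
    (δ : ℝ) (hδ0 : 0 < δ) (hδT : δ ≤ T)
    (u : ℝ → Euc d → ℝ)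
    (huCont : ContinuousOn (fun q : ℝ × Euc d => u q.1 q.2) (Set.Icc 0 δ ×ˢ Set.univ))
    (huC12 : IsC12On (Set.Ioc 0 δ) u)
    (huBnd : ∀ t ∈ Set.Icc (0 : ℝ) δ, ∀ y, |u t y| ≤ t * η y)
    (hstar : SolvesStar p θ δ b σ η lam gam u) :
    (∀ t ∈ Set.Ico (T - δ) T, ∀ y, 0 ≤ sepV T p η u t y) ∧
    IsC12On (Set.Ico (T - δ) T) (sepV T p η u) ∧
    (∀ t ∈ Set.Ico (T - δ) T, ∀ y,
      partialT (Set.Ico (T - δ) T) (sepV T p η u) t y + Lop b σ (sepV T p η u) t y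
        + hjbF p θ η lam gam y (sepV T p η u t y) = 0) ∧
    ((∃ R > 0, ∀ t ∈ Set.Icc (0 : ℝ) δ, ∀ y, |u t y| ≤ R * t ^ 2) →
      ∀ M : ℝ, ∃ t₀, T - δ ≤ t₀ ∧ t₀ < T ∧
        ∀ t, t₀ ≤ t → t < T → ∀ y, M ≤ sepV T p η u t y) := by
  have hmaps : ∀ t ∈ Set.Ico (T - δ) T, T - t ∈ Set.Ioc 0 δ := by
    intro t ht
    exact ⟨by linarith [ht.2], by linarith [ht.1]⟩
  have hη0 : ∀ y, 0 < η y := fun y => lt_of_lt_of_le hκ₀ (hηκ y)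
  obtain ⟨hu1, hu2, hu3, hu4, hu5⟩ := huC12
  have hud : UniqueDiffOn ℝ (Set.Ico (T - δ) T) := uniqueDiffOn_Ico _ _
  -- time derivative
  have hder : ∀ t ∈ Set.Ico (T - δ) T, ∀ y, HasDerivWithinAt (fun r => sepV T p η u r y)
      (η y * ((p - 1) * (T - t) ^ (-p)) + (-(partialT (Set.Ioc 0 δ) u (T - t) y) * (T - t) ^ (-p)
        + u (T - t) y * (p * (T - t) ^ (-p - 1)))) (Set.Ico (T - δ) T) t := by
    intro t ht y
    have hτ := hmaps t ht
    have h0 : HasDerivAt (fun r : ℝ => T - r) (-1) t := by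
      simpa using (hasDerivAt_id t).const_sub T
    have h1 : HasDerivAt (fun r : ℝ => (T - r) ^ (-(p - 1))) ((p - 1) * (T - t) ^ (-p)) t := by
      convert h0.rpow_const (p := -(p - 1)) (Or.inl hτ.1.ne') using 1
      rw [show -(p - 1) - 1 = -p by ring]; ring
    have h2 : HasDerivAt (fun r : ℝ => (T - r) ^ (-p)) (p * (T - t) ^ (-p - 1)) t := by
      convert h0.rpow_const (p := -p) (Or.inl hτ.1.ne') using 1
      ring
    have h3 : HasDerivWithinAt (fun r => u (T - r) y) (-(partialT (Set.Ioc 0 δ) u (T - t) y))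
        (Set.Ico (T - δ) T) t := by
      have := (hu1 (T - t) hτ y).hasDerivWithinAt.comp t h0.hasDerivWithinAt hmaps
      rw [mul_neg_one] at this
      exact this
    exact (h1.hasDerivWithinAt.const_mul (η y)).add (h3.mul h2.hasDerivWithinAt)
  have hpt : ∀ t ∈ Set.Ico (T - δ) T, ∀ y, partialT (Set.Ico (T - δ) T) (sepV T p η u) t y =
      (η y * ((p - 1) * (T - t) ^ (-p)) + (-(partialT (Set.Ioc 0 δ) u (T - t) y) * (T - t) ^ (-p)
        + u (T - t) y * (p * (T - t) ^ (-p - 1)))) := by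
    intro t ht y
    exact (hder t ht y).derivWithin (hud t ht)
  have hsp : ∀ t, sepV T p η u t =
      fun y => η y * (T - t) ^ (-(p - 1)) + u (T - t) y * (T - t) ^ (-p) := fun t => rfl
  have hcm : ContinuousOn (fun q : ℝ × Euc d => (T - q.1, q.2))
      (Set.Ico (T - δ) T ×ˢ Set.univ) := by fun_prop
  have hmm : Set.MapsTo (fun q : ℝ × Euc d => (T - q.1, q.2)) (Set.Ico (T - δ) T ×ˢ Set.univ)
      (Set.Ioc 0 δ ×ˢ Set.univ) := fun q hq => ⟨hmaps q.1 hq.1, trivial⟩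
  have hcp : ∀ a : ℝ, ContinuousOn (fun q : ℝ × Euc d => (T - q.1) ^ a)
      (Set.Ico (T - δ) T ×ˢ Set.univ) := by
    intro a
    refine ContinuousOn.rpow_const (by fun_prop) (fun q hq => Or.inl (hmaps q.1 hq.1).1.ne')
  have hcu := hu3.comp hcm hmm
  have hcut := hu4.comp hcm hmm
  have hcuh := hu5.comp hcm hmm
  have hcη : ContinuousOn (fun q : ℝ × Euc d => η q.2) (Set.Ico (T - δ) T ×ˢ Set.univ) :=
    (hηC2.continuous.comp continuous_snd).continuousOn
  have hcηh : ContinuousOn (fun q : ℝ × Euc d => fderiv ℝ (fun z => fderiv ℝ η z) q.2)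
      (Set.Ico (T - δ) T ×ˢ Set.univ) :=
    (((hηC2.fderiv_right (m := 1) (by norm_num)).continuous_fderiv
      (by norm_num)).comp continuous_snd).continuousOn
  refine ⟨?_, ⟨?_, ?_, ?_, ?_, ?_⟩, ?_, ?_⟩
  · intro t ht y
    have hτ := hmaps t ht
    have hU := (abs_le.1 (huBnd (T - t) ⟨hτ.1.le, hτ.2⟩ y)).1
    have h1 : (T - t) ^ (-(p - 1)) = (T - t) * (T - t) ^ (-p) := by
      rw [show -(p - 1) = 1 + -p by ring, Real.rpow_add hτ.1, Real.rpow_one]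
    have : sepV T p η u t y = ((T - t) * η y + u (T - t) y) * (T - t) ^ (-p) := by
      unfold sepV; rw [h1]; ring
    rw [this]
    exact mul_nonneg (by linarith) (Real.rpow_nonneg hτ.1.le _)
  · intro t ht y
    exact (hder t ht y).differentiableWithinAt
  · intro t ht
    have := hu2 _ (hmaps t ht)
    rw [hsp]
    fun_prop
  · exact (hcη.mul (hcp _)).add (hcu.mul (hcp _))
  · refine ContinuousOn.congr ?_ (fun q hq => hpt q.1 hq.1 q.2)
    exact (hcη.mul (continuousOn_const.mul (hcp _))).add
      ((hcut.neg.mul (hcp _)).add (hcu.mul (continuousOn_const.mul (hcp _))))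
  · refine ContinuousOn.congr (f := fun q : ℝ × Euc d =>
      (T - q.1) ^ (-(p - 1)) • fderiv ℝ (fun z => fderiv ℝ η z) q.2
        + (T - q.1) ^ (-p) • fderiv ℝ (fun z => fderiv ℝ (u (T - q.1)) z) q.2) ?_
        (fun q hq => ?_)
    · exact ((hcp _).smul hcηh).add ((hcp _).smul hcuh)
    · exact fderiv2_lin hηC2 (hu2 _ (hmaps q.1 hq.1)) _ _ q.2
  · intro t ht y
    have hτ := hmaps t ht
    have hU := huBnd (T - t) ⟨hτ.1.le, hτ.2⟩ y
    have hpos : 0 < (T - t) * η y := mul_pos hτ.1 (hη0 y)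
    have hx : |u (T - t) y / ((T - t) * η y)| ≤ 1 := by
      rw [abs_div, abs_of_pos hpos, div_le_one hpos]
      exact hU
    have hβ : 0 < 1 / (p - 1) + 1 := by
      have : 0 < p - 1 := by linarith
      positivity
    rw [hpt t ht y, Lop_lin b σ hηC2 (hu2 _ hτ) _ _ (hsp t) y]
    exact key_alg p θ (T - t) (η y) (lam y) (gam y) (u (T - t) y) _ _ _ _ _ hp hτ.1 (hη0 y)
      (hgam0 y) hU (tsum_rbinom_two _ hβ _ hx) rfl (hstar (T - t) hτ y)
  · rintro ⟨R, hR, hRb⟩ M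
    have hp1 : 0 < p - 1 := by linarith
    have hlim : Filter.Tendsto (fun τ : ℝ => τ ^ (-(p - 1)))
        (nhdsWithin 0 (Set.Ioi 0)) Filter.atTop := tendsto_rpow_neg_nhdsGT_zero (by linarith)
    have hev := hlim.eventually_ge_atTop (M / (κ₀ / 2))
    obtain ⟨ε, hε, hεs⟩ := mem_nhdsGT_iff_exists_Ioo_subset.1 hev
    have hε : 0 < ε := hε
    set ρ := min (min (ε / 2) δ) (κ₀ / (2 * R)) with hρ
    have hρ0 : 0 < ρ := by positivity
    have hρ1 : ρ ≤ ε / 2 := (min_le_left _ _).trans (min_le_left _ _)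
    have hρ2 : ρ ≤ δ := (min_le_left _ _).trans (min_le_right _ _)
    have hρ3 : ρ ≤ κ₀ / (2 * R) := min_le_right _ _
    refine ⟨T - ρ, by linarith, by linarith, fun t ht1 ht2 y => ?_⟩
    have hτ0 : 0 < T - t := by linarith
    have hτρ : T - t ≤ ρ := by linarith
    have hU := (abs_le.1 (hRb (T - t) ⟨hτ0.le, by linarith⟩ y)).1
    have hbig : M / (κ₀ / 2) ≤ (T - t) ^ (-(p - 1)) := hεs ⟨hτ0, by linarith⟩
    rw [div_le_iff₀ (by positivity)] at hbig
    have h1 : (T - t) ^ (-(p - 1)) = (T - t) * (T - t) ^ (-p) := by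
      rw [show -(p - 1) = 1 + -p by ring, Real.rpow_add hτ0, Real.rpow_one]
    have hRt : R * (T - t) ≤ κ₀ / 2 := by
      have := hτρ.trans hρ3
      rw [le_div_iff₀ (by positivity)] at this
      linarith
    have hq : 0 ≤ (T - t) ^ (-p) := Real.rpow_nonneg hτ0.le _
    have hs : sepV T p η u t y = ((T - t) * η y + u (T - t) y) * (T - t) ^ (-p) := by
      unfold sepV; rw [h1]; ring
    have hlow : (T - t) * (κ₀ / 2) ≤ (T - t) * η y + u (T - t) y := by
      have h2 := mul_le_mul_of_nonneg_left (hηκ y) hτ0.le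
      have h3 := mul_le_mul_of_nonneg_left hRt hτ0.le
      nlinarith
    rw [hs]
    calc M ≤ (T - t) ^ (-(p - 1)) * (κ₀ / 2) := hbig
      _ = (T - t) * (κ₀ / 2) * (T - t) ^ (-p) := by rw [h1]; ring
      _ ≤ _ := mul_le_mul_of_nonneg_right hlow hq
end
end
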